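/- arXiv:1308.2698 — 6 statements merged into one kernel-verified Lean document; each statement's English description precedes it below -/
import Mathlib

section
/- Let M be a positroid on the ordered ground set {1 < 2 < ... < n}. Then for any 1 ≤ a ≤ n, M is also a positroid on the ordered ground set {a < a+1 < ... < n < 1 < ... < a−1}. Equivalently, the matroid on [n] obtained from M by relabeling each element i by its image under the cyclic shift i ↦ i − a + 1 (taken mod n with representatives in {1,...,n}) is again a positroid on [n]. -/
open Finset

/-- A full-row-rank real `d × n` matrix is *totally nonnegative* if all of its
maximal (`d × d`) minors are nonnegative.  Columns are indexed by a finite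
linearly ordered set `E`; a maximal minor is indexed by a strictly increasing
choice of `d` columns. -/
def Matrix.TotallyNonneg {d : ℕ} {E : Type*} [Fintype E] [LinearOrder E]
    (A : Matrix (Fin d) E ℝ) : Prop :=
  A.rank = d ∧ ∀ f : Fin d → E, StrictMono f → 0 ≤ (A.submatrix id f).det

/-- `ℬ` is the collection of bases of the column matroid `M(A)`: the `d`-element
sets of column indices whose columns are linearly independent. -/
def Matrix.RepresentsBases {d : ℕ} {E : Type*} [Fintype E]
    (A : Matrix (Fin d) E ℝ) (ℬ : Finset E → Prop) : Prop :=
  ∀ B : Finset E, ℬ B ↔ B.card = d ∧ LinearIndependent ℝ (fun j : B => fun i => A i j.1)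

/-- A positroid of rank `d` on the finite linearly ordered ground set `E`,
given by its collection of bases `ℬ`. -/
def IsPositroidOfRank (d : ℕ) {E : Type*} [Fintype E] [LinearOrder E]
    (ℬ : Finset E → Prop) : Prop :=
  ∃ A : Matrix (Fin d) E ℝ, A.TotallyNonneg ∧ A.RepresentsBases ℬ

/-- A positroid on the finite linearly ordered ground set `E`. -/
def IsPositroid {E : Type*} [Fintype E] [LinearOrder E] (ℬ : Finset E → Prop) : Prop :=
  ∃ d, IsPositroidOfRank d ℬ



theorem positroid_shift_one (m : ℕ) (ℬ : Finset (Fin (m+1)) → Prop)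
    (hM : IsPositroid ℬ) :
    IsPositroid (fun B : Finset (Fin (m+1)) => ℬ (B.image (fun i => i + 1))) := by
  obtain ⟨d, A, ⟨hr, hA⟩, hB⟩ := hM
  let s : Fin (m+1) → ℝˣ := fun i => if i = Fin.last m then (-1)^(d+1) else 1
  let e : Fin (m+1) ≃ Fin (m+1) := Equiv.addRight 1
  let D : Matrix (Fin (m+1)) (Fin (m+1)) ℝ := Matrix.diagonal (fun i => (s i : ℝ))
  have hcol : ∀ i j, (A.submatrix id e * D) i j = A i (j+1) * (s j : ℝ) := by
    intro i j
    simp [D, e, Matrix.mul_diagonal]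
  refine ⟨d, A.submatrix id e * D, ⟨?_, ?_⟩, ?_⟩
  · rw [Matrix.rank_mul_eq_left_of_isUnit_det]
    · exact (Matrix.rank_submatrix A (Equiv.refl _) e).trans hr
    · rw [Matrix.det_diagonal]
      rw [isUnit_iff_ne_zero, Finset.prod_ne_zero_iff]
      intro i _
      exact (s i).ne_zero
  · intro f hf
    by_cases h : ∃ i, f i = Fin.last m
    · obtain ⟨i, hi⟩ := h
      cases d with
      | zero => exact i.elim0
      | succ k =>
        have hl : f (Fin.last k) = Fin.last m := by
          apply le_antisymm (Fin.le_last _)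
          rw [← hi]
          exact hf.monotone (Fin.le_last _)
        have hlt : ∀ i : Fin k, f i.castSucc < Fin.last m := by
          intro i
          rw [← hl]
          exact hf (Fin.castSucc_lt_last i)
        let g : Fin (k+1) → Fin (m+1) := Fin.cons 0 (fun i => f i.castSucc + 1)
        have hg : StrictMono g := by
          intro a b hab
          have hv : ∀ i : Fin k, (f i.castSucc + 1 : Fin (m+1)).val = (f i.castSucc).val + 1 :=
            fun i => Fin.val_add_one_of_lt (hlt i)
          induction b using Fin.cases with
          | zero => exact absurd hab (Fin.not_lt_zero a)
          | succ b =>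
            induction a using Fin.cases with
            | zero =>
              simp only [g, Fin.cons_zero, Fin.cons_succ]
              rw [Fin.lt_def, hv]
              simp
            | succ a =>
              simp only [g, Fin.cons_succ]
              rw [Fin.lt_def, hv, hv]
              have : f a.castSucc < f b.castSucc := hf (by simpa using hab)
              rw [Fin.lt_def] at this
              omega
        have key : (A.submatrix id e * D).submatrix id f =
            ((A.submatrix id g).submatrix id (finRotate (k+1))) *
              Matrix.diagonal (fun j => (s (f j) : ℝ)) := by
          ext i j
          rw [Matrix.mul_diagonal, Matrix.submatrix_apply, hcol]
          simp only [Matrix.submatrix_apply, id]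
          congr 2
          induction j using Fin.lastCases with
          | last => simp [g, hl]
          | cast j => simp [g, Fin.coeSucc_eq_succ]
        rw [key, Matrix.det_mul, Matrix.det_permute', Matrix.det_diagonal, Fin.prod_univ_castSucc]
        have h1 : ∀ i : Fin k, s (f i.castSucc) = 1 := fun i => if_neg (hlt i).ne
        have h2 : s (f (Fin.last k)) = (-1)^(k+1+1) := if_pos hl
        simp only [h1, h2, sign_finRotate]
        have h3 : ((-1:ℝ)^k * (-1)^(k+1+1)) = 1 := by
          rw [← pow_add]
          exact Even.neg_one_pow ⟨k+1, by ring⟩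
        have := hA g hg
        push_cast
        simp only [Finset.prod_const_one, one_mul]
        calc (0:ℝ) ≤ (A.submatrix id g).det := this
          _ = ((-1:ℝ)^k * (-1)^(k+1+1)) * (A.submatrix id g).det := by rw [h3, one_mul]
          _ = _ := by push_cast; ring
    · push Not at h
      have : (A.submatrix id e * D).submatrix id f = A.submatrix id (fun i => f i + 1) := by
        ext i j
        rw [Matrix.submatrix_apply, hcol]
        simp [s, h j]
      rw [this]
      apply hA
      intro a b hab
      have hv : ∀ i, (f i + 1 : Fin (m+1)).val = (f i).val + 1 :=
            fun i => Fin.val_add_one_of_lt (lt_of_le_of_ne (Fin.le_last _) (h i))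
      show f a + 1 < f b + 1
      rw [Fin.lt_def, hv, hv]
      have := hf hab
      rw [Fin.lt_def] at this
      omega
  · intro B
    show ℬ _ ↔ _
    have hinj : Function.Injective (fun i : Fin (m+1) => i + 1) := add_left_injective 1
    rw [hB, Finset.card_image_of_injective _ hinj]
    refine and_congr_right fun _ => ?_
    have hmem : ∀ x, x ∈ B ↔ e x ∈ B.image (fun i => i + 1) := by
      intro x
      exact (hinj.mem_finset_image).symm
    let e' : B ≃ (B.image (fun i => i + 1) : Finset (Fin (m+1))) := e.subtypeEquiv hmem
    rw [← linearIndependent_equiv e']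
    have hh : (fun j : B => fun i => (A.submatrix id e * D) i j.1) =
        (fun j : B => s j.1) • (fun j : B => fun i => A i (j.1+1)) := by
      ext j i
      rw [hcol]
      simp [Units.smul_def, mul_comm]
    rw [hh, LinearIndependent.units_smul_iff]
    rfl

theorem positroid_cyclic_shift (n : ℕ) (ℬ : Finset (Fin n) → Prop)
    (hM : IsPositroid ℬ) (a : Fin n) :
    IsPositroid (fun B : Finset (Fin n) => ℬ (B.image (fun i => i + a))) := by
  cases n with
  | zero => exact a.elim0
  | succ m =>
    induction a using Fin.induction with
    | zero => simpa using hM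
    | succ k ih =>
      have := positroid_shift_one m _ ih
      simp only [Finset.image_image] at this
      convert this using 4
      funext i
      simp only [Function.comp]
      rw [← Fin.coeSucc_eq_succ, add_assoc, add_comm 1]
end

section
/- Suppose [n] is the disjoint union of two cyclic intervals [ℓ+1,m] and [m+1,ℓ]. Let M be a positroid on the totally ordered set [ℓ+1,m] and let M′ be a positroid on the totally ordered set [m+1,ℓ]. Then the direct sum M ⊕ M′ is a positroid on the ordered ground set [n] = {1 < 2 < ... < n}. -/
open Finset

theorem det_ne_zero_iff_li {d : ℕ} {E : Type*} [Fintype E] (A : Matrix (Fin d) E ℝ)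
    (f : Fin d → E) : (A.submatrix id f).det ≠ 0 ↔
      LinearIndependent ℝ (fun j : Fin d => fun i => A i (f j)) := by
  have h := Matrix.linearIndependent_cols_iff_isUnit (A := A.submatrix id f)
  rw [Matrix.isUnit_iff_isUnit_det, isUnit_iff_ne_zero] at h
  exact h.symm

theorem basis_iff {d : ℕ} {E : Type*} [Fintype E] [DecidableEq E] (A : Matrix (Fin d) E ℝ)
    (B : Finset E) :
    (B.card = d ∧ LinearIndependent ℝ (fun j : B => fun i => A i j.1)) ↔
      ∃ f : Fin d → E, univ.image f = B ∧ (A.submatrix id f).det ≠ 0 := by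
  constructor
  · rintro ⟨hc, hl⟩
    let e : Fin d ≃ B := (B.equivFinOfCardEq hc).symm
    refine ⟨fun i => (e i).1, ?_, ?_⟩
    · ext x
      simp only [mem_image, mem_univ, true_and]
      constructor
      · rintro ⟨i, rfl⟩
        exact (e i).2
      · intro hx
        exact ⟨e.symm ⟨x, hx⟩, by simp⟩
    · rw [det_ne_zero_iff_li]
      exact hl.comp e e.injective
  · rintro ⟨f, rfl, hf⟩
    rw [det_ne_zero_iff_li] at hf
    have hinj : Function.Injective f := by
      intro a b hab
      apply hf.injective
      simp only [hab]
    refine ⟨by rw [card_image_of_injective _ hinj]; simp, ?_⟩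
    let e : Fin d ≃ (univ.image f : Finset E) := Equiv.ofBijective
      (fun i => ⟨f i, mem_image_of_mem _ (mem_univ _)⟩) (by
        constructor
        · intro a b hab
          exact hinj (congrArg Subtype.val hab)
        · rintro ⟨x, hx⟩
          obtain ⟨i, -, rfl⟩ := mem_image.1 hx
          exact ⟨i, rfl⟩)
    exact (linearIndependent_equiv e).1 hf

theorem rank_iff {d : ℕ} {E : Type*} [Fintype E] [DecidableEq E] (A : Matrix (Fin d) E ℝ) :
    A.rank = d ↔ ∃ f : Fin d → E, (A.submatrix id f).det ≠ 0 := by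
  constructor
  · intro h
    rw [Matrix.rank_eq_finrank_span_cols] at h
    obtain ⟨f, h1, -, h3⟩ := Submodule.exists_fun_fin_finrank_span_eq ℝ (Set.range A.col)
    choose g hg using h1
    refine ⟨fun i => g (Fin.cast h.symm i), ?_⟩
    rw [det_ne_zero_iff_li]
    have : (fun j : Fin d => fun i => A i (g (Fin.cast h.symm j))) = f ∘ Fin.cast h.symm := by
      funext j
      exact hg _
    rw [this]
    exact h3.comp _ (Fin.cast_injective _)
  · rintro ⟨f, hf⟩
    apply le_antisymm
    · exact (Matrix.rank_le_card_height A).trans (Fintype.card_fin d).le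
    · have h1 : (A.submatrix id f).rank = d := by
        have := Matrix.rank_of_isUnit (A.submatrix id f)
          ((Matrix.isUnit_iff_isUnit_det _).2 (isUnit_iff_ne_zero.2 hf))
        simpa using this
      calc d = (A.submatrix id f).rank := h1.symm
        _ ≤ A.rank := by
          rw [Matrix.rank_eq_finrank_span_cols, Matrix.rank_eq_finrank_span_cols]
          apply Submodule.finrank_mono
          apply Submodule.span_mono
          rintro _ ⟨i, rfl⟩
          exact ⟨f i, rfl⟩

theorem isPositroid_iff {E : Type*} [Fintype E] [LinearOrder E] (ℬ : Finset E → Prop) :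
    IsPositroid ℬ ↔ ∃ (d : ℕ) (A : Matrix (Fin d) E ℝ),
      (∃ f : Fin d → E, (A.submatrix id f).det ≠ 0) ∧
      (∀ f : Fin d → E, StrictMono f → 0 ≤ (A.submatrix id f).det) ∧
      ∀ B, ℬ B ↔ ∃ f : Fin d → E, univ.image f = B ∧ (A.submatrix id f).det ≠ 0 := by
  simp only [IsPositroid, IsPositroidOfRank, Matrix.TotallyNonneg, Matrix.RepresentsBases,
    rank_iff, basis_iff, and_assoc]

theorem rotate_det {m d : ℕ} (A : Matrix (Fin d) (Fin (m+1)) ℝ) (e : Fin (m+1) → ℝ)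
    (f : Fin d → Fin (m+1)) :
    ((Matrix.of fun i j => e j * A i (j - 1)).submatrix id f).det
      = (∏ i, e (f i)) * (A.submatrix id (fun i => f i - 1)).det := by
  rw [← Matrix.det_mul_row]
  rfl

theorem val_sub_one' {m : ℕ} (x : Fin (m+1)) (h : x ≠ 0) : ((x - 1 : Fin (m+1)) : ℕ) = x - 1 := by
  rw [Fin.val_sub_one_of_ne_zero h]

theorem rotate_one {m : ℕ} (ℬ : Finset (Fin (m+1)) → Prop) (h : IsPositroid ℬ) :
    IsPositroid (fun B => ℬ (B.image (fun x => x - 1))) := by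
  rw [isPositroid_iff] at h ⊢
  obtain ⟨d, A, ⟨f₀, hf₀⟩, hpos, hB⟩ := h
  let e : Fin (m+1) → ℝ := fun j => if j = 0 then (-1) ^ (d+1) else 1
  have he : ∀ j, e j ≠ 0 := by
    intro j
    simp only [e]
    split_ifs <;> simp
  have hdet : ∀ f : Fin d → Fin (m+1),
      ((Matrix.of fun i j => e j * A i (j - 1)).submatrix id f).det ≠ 0 ↔
      (A.submatrix id (fun i => f i - 1)).det ≠ 0 := by
    intro f
    rw [rotate_det]
    have : (∏ i, e (f i)) ≠ 0 := prod_ne_zero_iff.2 (fun i _ => he _)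
    simp [this]
  refine ⟨d, Matrix.of fun i j => e j * A i (j - 1), ⟨fun i => f₀ i + 1, ?_⟩, ?_, ?_⟩
  · rw [hdet]
    simpa using hf₀
  · intro f hf
    rcases d with _ | d
    · simp
    rw [rotate_det]
    have hne : ∀ i : Fin d, f i.succ ≠ 0 := fun i => by
      have := hf (Fin.succ_pos i)
      exact (lt_of_le_of_lt (Fin.zero_le _) this).ne'
    by_cases h0 : f 0 = 0
    · have hprod : (∏ i, e (f i)) = (-1) ^ d := by
        rw [Fin.prod_univ_succ]
        simp [e, h0, hne, pow_succ]
      have hg := hpos (fun i => f (finRotate _ i) - 1) (by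
        intro i j hij
        rcases Fin.eq_castSucc_or_eq_last i with ⟨i, rfl⟩ | rfl
        · rcases Fin.eq_castSucc_or_eq_last j with ⟨j, rfl⟩ | rfl
          · simp only [finRotate_apply, Fin.coeSucc_eq_succ]
            rw [Fin.lt_def, val_sub_one' _ (hne _), val_sub_one' _ (hne _)]
            have h1 : f i.succ < f j.succ := hf (Fin.succ_lt_succ_iff.2 hij)
            have h2 := hne i
            rw [← Fin.val_ne_zero_iff] at h2
            rw [Fin.lt_def] at h1
            omega
          · simp only [finRotate_apply, Fin.coeSucc_eq_succ, Fin.last_add_one, h0]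
            rw [Fin.lt_def, val_sub_one' _ (hne _)]
            have h2 := hne i
            rw [← Fin.val_ne_zero_iff] at h2
            have : (0 - 1 : Fin (m+1)) = Fin.last m := by
              rw [sub_eq_iff_eq_add, Fin.last_add_one]
            rw [this, Fin.val_last]
            omega
        · exact absurd hij (not_lt.2 (Fin.le_last _)))
      have hperm := Matrix.det_permute' (finRotate (d+1)) (A.submatrix id (fun i => f i - 1))
      rw [sign_finRotate] at hperm
      rw [hprod]
      have h3 : (A.submatrix id (fun i => f i - 1)).submatrix id (finRotate (d+1))
        = A.submatrix id (fun i => f (finRotate _ i) - 1) := rfl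
      rw [h3] at hperm
      rw [hperm] at hg
      simpa using hg
    · have hne' : ∀ i, f i ≠ 0 := fun i => by
        refine Fin.cases h0 hne i
      have hprod : (∏ i, e (f i)) = 1 := by
        apply prod_eq_one
        intro i _
        simp [e, hne' i]
      rw [hprod, one_mul]
      apply hpos
      intro i j hij
      rw [Fin.lt_def, val_sub_one' _ (hne' _), val_sub_one' _ (hne' _)]
      have h1 := hf hij
      have h2 := hne' i
      rw [← Fin.val_ne_zero_iff] at h2
      rw [Fin.lt_def] at h1
      omega
  · intro B
    rw [hB]
    constructor
    · rintro ⟨f, hf, hd⟩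
      refine ⟨fun i => f i + 1, ?_, ?_⟩
      · have : B = (B.image (fun x => x - 1)).image (fun x => x + 1) := by
          simp [image_image, Function.comp_def]
        rw [this, ← hf, image_image]
        rfl
      · rw [hdet]
        simpa using hd
    · rintro ⟨f, rfl, hd⟩
      rw [hdet] at hd
      exact ⟨_, by rw [image_image]; rfl, hd⟩

theorem rotate {m : ℕ} (ℬ : Finset (Fin (m+1)) → Prop) (h : IsPositroid ℬ) (s : Fin (m+1)) :
    IsPositroid (fun B => ℬ (B.image (fun x => x - s))) := by
  induction s using Fin.induction with
  | zero => simpa using h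
  | succ t ih =>
    have := rotate_one _ ih
    simp only [image_image, Function.comp_def] at this
    have e : ∀ x : Fin (m+1), x - 1 - t.castSucc = x - t.succ := fun x => by
      rw [← Fin.coeSucc_eq_succ]
      abel
    simpa only [e] using this

def blk {d₁ d₂ k₁ k₂ : ℕ} (A₁ : Matrix (Fin d₁) (Fin k₁) ℝ) (A₂ : Matrix (Fin d₂) (Fin k₂) ℝ) :
    Matrix (Fin (d₁ + d₂)) (Fin (k₁ + k₂)) ℝ :=
  (Matrix.fromBlocks A₁ 0 0 A₂).submatrix finSumFinEquiv.symm finSumFinEquiv.symm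

theorem blk_det {d₁ d₂ k₁ k₂ : ℕ} (A₁ : Matrix (Fin d₁) (Fin k₁) ℝ)
    (A₂ : Matrix (Fin d₂) (Fin k₂) ℝ) (f : Fin (d₁ + d₂) → Fin (k₁ + k₂))
    (f₁ : Fin d₁ → Fin k₁) (f₂ : Fin d₂ → Fin k₂)
    (h₁ : ∀ i, f (Fin.castAdd d₂ i) = Fin.castAdd k₂ (f₁ i))
    (h₂ : ∀ i, f (Fin.natAdd d₁ i) = Fin.natAdd k₁ (f₂ i)) :
    ((blk A₁ A₂).submatrix id f).det = (A₁.submatrix id f₁).det * (A₂.submatrix id f₂).det := by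
  rw [← Matrix.det_fromBlocks_zero₂₁ _ 0, ← Matrix.det_submatrix_equiv_self finSumFinEquiv]
  congr 1
  ext i j
  rcases i with i | i <;> rcases j with j | j <;> simp [blk, h₁, h₂]

theorem blk_same_side {d₁ d₂ k₁ k₂ : ℕ} (A₁ : Matrix (Fin d₁) (Fin k₁) ℝ)
    (A₂ : Matrix (Fin d₂) (Fin k₂) ℝ) (i : Fin (d₁ + d₂)) (j : Fin (k₁ + k₂))
    (h : blk A₁ A₂ i j ≠ 0) : (j : ℕ) < k₁ ↔ (i : ℕ) < d₁ := by
  induction i using Fin.addCases <;> induction j using Fin.addCases <;> simp_all [blk]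

theorem blk_perm {d₁ d₂ k₁ k₂ : ℕ} (A₁ : Matrix (Fin d₁) (Fin k₁) ℝ)
    (A₂ : Matrix (Fin d₂) (Fin k₂) ℝ) (f : Fin (d₁ + d₂) → Fin (k₁ + k₂))
    (h : ((blk A₁ A₂).submatrix id f).det ≠ 0) :
    ∃ σ : Equiv.Perm (Fin (d₁ + d₂)), ∀ i, (f i : ℕ) < k₁ ↔ (σ i : ℕ) < d₁ := by
  rw [Matrix.det_apply] at h
  obtain ⟨σ, -, hσ⟩ := exists_ne_zero_of_sum_ne_zero h
  refine ⟨σ, fun i => ?_⟩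
  have h1 : ∏ i, ((blk A₁ A₂).submatrix id f) (σ i) i ≠ 0 := by
    intro h0
    rw [h0] at hσ
    simp at hσ
  exact blk_same_side A₁ A₂ _ _ (prod_ne_zero_iff.1 h1 i (mem_univ _))

theorem split_fun {d₁ d₂ k₁ k₂ : ℕ} (f : Fin (d₁ + d₂) → Fin (k₁ + k₂))
    (h : ∀ i, (f i : ℕ) < k₁ ↔ (i : ℕ) < d₁) :
    ∃ (f₁ : Fin d₁ → Fin k₁) (f₂ : Fin d₂ → Fin k₂),
      (∀ i, f (Fin.castAdd d₂ i) = Fin.castAdd k₂ (f₁ i)) ∧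
      (∀ i, f (Fin.natAdd d₁ i) = Fin.natAdd k₁ (f₂ i)) := by
  have h2 : ∀ i : Fin d₂, k₁ ≤ (f (Fin.natAdd d₁ i) : ℕ) := fun i => by
    have := h (Fin.natAdd d₁ i)
    simp only [Fin.val_natAdd] at this
    omega
  refine ⟨fun i => ⟨f (Fin.castAdd d₂ i), (h _).2 (by simp)⟩,
    fun i => ⟨f (Fin.natAdd d₁ i) - k₁, by have := h2 i; omega⟩, fun i => rfl, fun i => ?_⟩
  ext
  have := h2 i
  simp only [Fin.val_natAdd]
  omega

theorem mono_side {d₁ d₂ k : ℕ} {n : ℕ} (f : Fin (d₁ + d₂) → Fin n) (hf : StrictMono f)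
    (σ : Equiv.Perm (Fin (d₁ + d₂))) (h : ∀ i, (f i : ℕ) < k ↔ (σ i : ℕ) < d₁)
    (i : Fin (d₁ + d₂)) : (f i : ℕ) < k ↔ (i : ℕ) < d₁ := by
  have hc : (univ.filter (fun i : Fin (d₁ + d₂) => (f i : ℕ) < k)).card = d₁ := by
    have e1 : (univ.filter (fun i : Fin (d₁ + d₂) => (f i : ℕ) < k)) =
        ((univ : Finset (Fin d₁)).image (fun j => σ.symm (Fin.castAdd d₂ j))) := by
      ext x
      simp only [mem_filter, mem_univ, true_and, mem_image, h]
      constructor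
      · intro hx
        exact ⟨⟨σ x, hx⟩, by rw [Equiv.symm_apply_eq]; rfl⟩
      · rintro ⟨j, rfl⟩
        simp
    rw [e1, card_image_of_injective]
    · simp
    · intro a b hab
      simpa using hab
  constructor
  · intro hi
    have : Finset.Iic i ⊆ univ.filter (fun i : Fin (d₁ + d₂) => (f i : ℕ) < k) := by
      intro x hx
      have h1 := hf.monotone (mem_Iic.1 hx)
      rw [Fin.le_def] at h1
      simp only [mem_filter, mem_univ, true_and]
      omega
    have := card_le_card this
    rw [hc, Fin.card_Iic] at this
    omega
  · intro hi
    by_contra hk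
    have : univ.filter (fun i : Fin (d₁ + d₂) => (f i : ℕ) < k) ⊆ Finset.Iio i := by
      intro x hx
      simp only [mem_filter, mem_univ, true_and] at hx
      rw [mem_Iio]
      by_contra hxi
      have h1 := hf.monotone (not_lt.1 hxi)
      rw [Fin.le_def] at h1
      omega
    have := card_le_card this
    rw [hc, Fin.card_Iio] at this
    omega

theorem image_split {d₁ d₂ k₁ k₂ : ℕ} (f : Fin (d₁ + d₂) → Fin (k₁ + k₂))
    (f₁ : Fin d₁ → Fin k₁) (f₂ : Fin d₂ → Fin k₂)
    (h₁ : ∀ i, f (Fin.castAdd d₂ i) = Fin.castAdd k₂ (f₁ i))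
    (h₂ : ∀ i, f (Fin.natAdd d₁ i) = Fin.natAdd k₁ (f₂ i)) :
    univ.image f = (univ.image f₁).image (Fin.castAdd k₂) ∪
      (univ.image f₂).image (Fin.natAdd k₁) := by
  ext x
  simp only [mem_image, mem_univ, true_and, mem_union, exists_exists_eq_and]
  constructor
  · rintro ⟨i, rfl⟩
    induction i using Fin.addCases with
    | left i => exact Or.inl ⟨i, (h₁ i).symm⟩
    | right i => exact Or.inr ⟨i, (h₂ i).symm⟩
  · rintro (⟨i, rfl⟩ | ⟨i, rfl⟩)
    · exact ⟨_, h₁ i⟩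
    · exact ⟨_, h₂ i⟩

theorem directSum_isPositroid {k₁ k₂ : ℕ}
    (ℬ₁ : Finset (Fin k₁) → Prop) (ℬ₂ : Finset (Fin k₂) → Prop)
    (hM : IsPositroid ℬ₁) (hM' : IsPositroid ℬ₂) :
    IsPositroid (fun B : Finset (Fin (k₁ + k₂)) =>
      ∃ (B₁ : Finset (Fin k₁)) (B₂ : Finset (Fin k₂)), ℬ₁ B₁ ∧ ℬ₂ B₂ ∧
        B = B₁.image (Fin.castAdd k₂) ∪ B₂.image (Fin.natAdd k₁)) := by
  rw [isPositroid_iff] at hM hM' ⊢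
  obtain ⟨d₁, A₁, ⟨g₁, hg₁⟩, hp₁, hB₁⟩ := hM
  obtain ⟨d₂, A₂, ⟨g₂, hg₂⟩, hp₂, hB₂⟩ := hM'
  have key : ∀ (f₁ : Fin d₁ → Fin k₁) (f₂ : Fin d₂ → Fin k₂),
      ∃ f : Fin (d₁ + d₂) → Fin (k₁ + k₂),
      (∀ i, f (Fin.castAdd d₂ i) = Fin.castAdd k₂ (f₁ i)) ∧
      (∀ i, f (Fin.natAdd d₁ i) = Fin.natAdd k₁ (f₂ i)) := fun f₁ f₂ =>
    ⟨Fin.append (Fin.castAdd k₂ ∘ f₁) (Fin.natAdd k₁ ∘ f₂), by simp, by simp⟩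
  refine ⟨d₁ + d₂, blk A₁ A₂, ?_, ?_, ?_⟩
  · obtain ⟨f, h1, h2⟩ := key g₁ g₂
    exact ⟨f, by rw [blk_det A₁ A₂ f g₁ g₂ h1 h2]; exact mul_ne_zero hg₁ hg₂⟩
  · intro f hf
    by_cases h0 : ((blk A₁ A₂).submatrix id f).det = 0
    · exact h0.ge
    obtain ⟨σ, hσ⟩ := blk_perm A₁ A₂ f h0
    obtain ⟨f₁, f₂, h1, h2⟩ := split_fun f (mono_side f hf σ hσ)
    rw [blk_det A₁ A₂ f f₁ f₂ h1 h2]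
    apply mul_nonneg
    · apply hp₁
      intro i j hij
      have : f (Fin.castAdd d₂ i) < f (Fin.castAdd d₂ j) := hf hij
      rw [h1, h1] at this
      exact this
    · apply hp₂
      intro i j hij
      have : f (Fin.natAdd d₁ i) < f (Fin.natAdd d₁ j) := hf (by simpa using hij)
      simpa [h2] using this
  · intro B
    constructor
    · rintro ⟨B₁, B₂, hb₁, hb₂, rfl⟩
      obtain ⟨f₁, rfl, hd₁⟩ := (hB₁ _).1 hb₁
      obtain ⟨f₂, rfl, hd₂⟩ := (hB₂ _).1 hb₂
      obtain ⟨f, h1, h2⟩ := key f₁ f₂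
      exact ⟨f, image_split f f₁ f₂ h1 h2,
        by rw [blk_det A₁ A₂ f f₁ f₂ h1 h2]; exact mul_ne_zero hd₁ hd₂⟩
    · rintro ⟨f, rfl, hd⟩
      obtain ⟨σ, hσ⟩ := blk_perm A₁ A₂ f hd
      obtain ⟨f₁, f₂, h1, h2⟩ := split_fun (f ∘ σ.symm) (fun i => by simp [hσ])
      have hd' : ((blk A₁ A₂).submatrix id (f ∘ σ.symm)).det ≠ 0 := by
        have := Matrix.det_permute' σ.symm ((blk A₁ A₂).submatrix id f)
        rw [Matrix.submatrix_submatrix] at this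
        change ((blk A₁ A₂).submatrix (id ∘ id) (f ∘ σ.symm)).det ≠ 0
        rw [this]
        refine mul_ne_zero ?_ hd
        rcases Int.units_eq_one_or (Equiv.Perm.sign σ.symm) with h | h <;> rw [h] <;> simp
      rw [blk_det A₁ A₂ _ f₁ f₂ h1 h2] at hd'
      refine ⟨univ.image f₁, univ.image f₂, (hB₁ _).2 ⟨f₁, rfl, left_ne_zero_of_mul hd'⟩,
        (hB₂ _).2 ⟨f₂, rfl, right_ne_zero_of_mul hd'⟩, ?_⟩
      rw [← image_split _ f₁ f₂ h1 h2]
      ext x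
      simp only [mem_image, mem_univ, true_and, Function.comp]
      exact ⟨fun ⟨i, hi⟩ => ⟨σ i, by simpa using hi⟩, fun ⟨i, hi⟩ => ⟨_, hi⟩⟩

theorem directSum_isPositroid' {k₁ k₂ n : ℕ} (hn : k₁ + k₂ = n)
    (ℬ₁ : Finset (Fin k₁) → Prop) (ℬ₂ : Finset (Fin k₂) → Prop)
    (hM : IsPositroid ℬ₁) (hM' : IsPositroid ℬ₂) :
    IsPositroid (fun B : Finset (Fin n) =>
      ∃ (B₁ : Finset (Fin k₁)) (B₂ : Finset (Fin k₂)), ℬ₁ B₁ ∧ ℬ₂ B₂ ∧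
        B = B₁.image (fun i => (Fin.castLE (by omega) i : Fin n)) ∪
          B₂.image (fun i : Fin k₂ => (⟨k₁ + i, by omega⟩ : Fin n))) := by
  subst hn
  exact directSum_isPositroid ℬ₁ ℬ₂ hM hM'

/-- Suppose `[n]` is the disjoint union of two (nonempty) cyclic
intervals `[ℓ+1, m]` and `[m+1, ℓ]`, of sizes `k₁` and `k₂` and with starting
points `s = ℓ+1` and `s + k₁ = m+1` respectively; each cyclic interval carries
the total order starting at its starting point, so it is order isomorphic to
`Fin k₁` (resp. `Fin k₂`) via `i ↦ s + i` (resp. `i ↦ s + k₁ + i`).  If `M` is a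
positroid on the first cyclic interval and `M'` is a positroid on the second,
then the direct sum `M ⊕ M'` — whose bases are the unions of (the images in
`Fin n` of) a basis of `M` and a basis of `M'` — is a positroid on
`[n] = {1 < ... < n}`. -/
theorem directSum_of_cyclicIntervals_isPositroid (n k₁ k₂ : ℕ)
    (hk₁ : 0 < k₁) (hk₂ : 0 < k₂) (hn : k₁ + k₂ = n) (s : Fin n)
    (ℬ₁ : Finset (Fin k₁) → Prop) (ℬ₂ : Finset (Fin k₂) → Prop)
    (hM : IsPositroid ℬ₁) (hM' : IsPositroid ℬ₂) :
    IsPositroid (fun B : Finset (Fin n) =>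
      ∃ (B₁ : Finset (Fin k₁)) (B₂ : Finset (Fin k₂)), ℬ₁ B₁ ∧ ℬ₂ B₂ ∧
        B = B₁.image (fun i => s + Fin.castLE (by omega) i) ∪
            B₂.image (fun i => s + (⟨k₁, by omega⟩ : Fin n) + Fin.castLE (by omega) i)) := by
  have h' := directSum_isPositroid' hn ℬ₁ ℬ₂ hM hM'
  obtain ⟨m, rfl⟩ : ∃ m, n = m + 1 := ⟨n - 1, by omega⟩
  have h'' := rotate _ h' s
  have hinj : Function.Injective (fun x : Fin (m + 1) => s + x) := fun a b hab => by
    simpa using hab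
  have e : ∀ (i : Fin k₂), (⟨k₁ + i, by omega⟩ : Fin (m + 1)) =
      (⟨k₁, by omega⟩ : Fin (m + 1)) + Fin.castLE (by omega) i := fun i => by
    ext
    rw [Fin.val_add, Fin.val_castLE]
    exact (Nat.mod_eq_of_lt (by omega)).symm
  have key : ∀ (B : Finset (Fin (m + 1))) (B₁ : Finset (Fin k₁)) (B₂ : Finset (Fin k₂)),
      (B.image (fun x => x - s) = B₁.image (fun i => (Fin.castLE (by omega) i : Fin (m + 1))) ∪
          B₂.image (fun i : Fin k₂ => (⟨k₁ + i, by omega⟩ : Fin (m + 1)))) ↔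
      B = B₁.image (fun i => s + Fin.castLE (by omega) i) ∪
            B₂.image (fun i => s + (⟨k₁, by omega⟩ : Fin (m + 1)) +
              Fin.castLE (by omega) i) := fun B B₁ B₂ => by
    rw [← (image_injective hinj).eq_iff]
    simp only [image_image, image_union, Function.comp_def, add_sub_cancel, image_id', add_assoc, e]
  simp only [key] at h''
  exact h''
end

section
/- Let M be a positroid on [n]. Then the dual matroid M*, the matroid on [n] whose bases are exactly the complements [n] − B of the bases B of M, is also a positroid on [n]. -/
open Finset

namespace PosDual

/-- The shuffle permutation attached to a `d`-subset. -/
def shuf {d e : ℕ} (s : Finset (Fin (d + e))) (hs : s.card = d) (hs' : sᶜ.card = e) :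
    Equiv.Perm (Fin (d + e)) :=
  finSumFinEquiv.symm.trans (finSumEquivOfFinset hs hs')

lemma shuf_castAdd {d e : ℕ} (s : Finset (Fin (d + e))) (hs : s.card = d) (hs' : sᶜ.card = e)
    (i : Fin d) : shuf s hs hs' (Fin.castAdd e i) = s.orderEmbOfFin hs i := by
  simp [shuf]

lemma shuf_natAdd {d e : ℕ} (s : Finset (Fin (d + e))) (hs : s.card = d) (hs' : sᶜ.card = e)
    (i : Fin e) : shuf s hs hs' (Fin.natAdd d i) = sᶜ.orderEmbOfFin hs' i := by
  simp [shuf]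

lemma sign_aux {d e : ℕ} (s : Finset (Fin (d + e))) (hs : s.card = d) (hs' : sᶜ.card = e)
    (j : Fin e) :
    (∏ i : Fin d, (if s.orderEmbOfFin hs i < sᶜ.orderEmbOfFin hs' j then (1 : ℤˣ) else -1)) =
      ((-1) ^ (d + e - 1) * ∏ j' : Fin e, (if j < j' then (-1 : ℤˣ) else 1)) *
        (-1) ^ (sᶜ.orderEmbOfFin hs' j : ℕ) := by
  have h1 : (∏ i : Fin d, (if s.orderEmbOfFin hs i < sᶜ.orderEmbOfFin hs' j
        then (1 : ℤˣ) else -1)) * ∏ j' : Fin e, (if j < j' then (-1 : ℤˣ) else 1) =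
      ∏ x : Fin (d + e), (if sᶜ.orderEmbOfFin hs' j < x then (-1 : ℤˣ) else 1) := by
    rw [← Equiv.prod_comp (finSumEquivOfFinset hs hs'), Fintype.prod_sum_type]
    congr 1
    · refine Finset.prod_congr rfl fun i _ => ?_
      rw [finSumEquivOfFinset_inl]
      have hne : s.orderEmbOfFin hs i ≠ sᶜ.orderEmbOfFin hs' j := by
        rw [← finSumEquivOfFinset_inl hs hs', ← finSumEquivOfFinset_inr hs hs']
        exact fun h => by simpa only [reduceCtorEq] using (finSumEquivOfFinset hs hs').injective h
      rcases lt_or_gt_of_ne hne with h | h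
      · rw [if_pos h, if_neg (not_lt.2 h.le)]
      · rw [if_neg (not_lt.2 h.le), if_pos h]
    · refine Finset.prod_congr rfl fun i _ => ?_
      simp
  have h2 : ∏ x : Fin (d + e), (if sᶜ.orderEmbOfFin hs' j < x then (-1 : ℤˣ) else 1) =
      (-1) ^ (d + e - 1) * (-1) ^ (sᶜ.orderEmbOfFin hs' j : ℕ) := by
    have hy := (sᶜ.orderEmbOfFin hs' j).2
    generalize sᶜ.orderEmbOfFin hs' j = y at *
    rw [Finset.prod_ite]
    simp only [Finset.prod_const, Finset.prod_const_one, mul_one]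
    have : (Finset.univ.filter fun x => y < x) = Finset.Ioi y := by ext; simp
    rw [this, Fin.card_Ioi]
    have : d + e - 1 = (d + e - 1 - y) + y := by omega
    conv_rhs => rw [this]
    rw [pow_add, mul_assoc, ← mul_pow]
    simp
  have h3 : (∏ j' : Fin e, (if j < j' then (-1 : ℤˣ) else 1)) *
      (∏ j' : Fin e, (if j < j' then (-1 : ℤˣ) else 1)) = 1 := Int.units_mul_self _
  rw [h2] at h1
  calc _ = ((∏ i : Fin d, (if s.orderEmbOfFin hs i < sᶜ.orderEmbOfFin hs' j
        then (1 : ℤˣ) else -1)) * ∏ j' : Fin e, (if j < j' then (-1 : ℤˣ) else 1)) *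
          ∏ j' : Fin e, (if j < j' then (-1 : ℤˣ) else 1) := by rw [mul_assoc, h3, mul_one]
    _ = _ := by rw [h1, mul_right_comm]

lemma sign_shuf (d e : ℕ) : ∃ c : ℤˣ, ∀ (s : Finset (Fin (d + e))) (hs : s.card = d)
    (hs' : sᶜ.card = e), Equiv.Perm.sign (shuf s hs hs') =
      c * ∏ j : Fin e, (-1) ^ (sᶜ.orderEmbOfFin hs' j : ℕ) := by
  refine ⟨∏ j : Fin e, ((-1) ^ (d + e - 1) * ∏ j' : Fin e, (if j < j' then (-1 : ℤˣ) else 1)),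
    fun s hs hs' => ?_⟩
  rw [← Finset.prod_mul_distrib]
  simp_rw [← sign_aux s hs hs']
  rw [Equiv.Perm.sign_eq_prod_prod_Iio]
  have : ∀ j : Fin (d + e), (∏ i ∈ Finset.Iio j, (if shuf s hs hs' i < shuf s hs hs' j
      then (1 : ℤˣ) else -1)) = ∏ i, if i < j then (if shuf s hs hs' i < shuf s hs hs' j
      then (1 : ℤˣ) else -1) else 1 := by
    intro j
    rw [← Finset.prod_filter]
    refine Finset.prod_congr ?_ fun _ _ => rfl
    ext; simp
  simp_rw [this]
  rw [Fin.prod_univ_add]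
  have hA : ∏ i : Fin d, ∏ i_1, (if i_1 < Fin.castAdd e i then
      (if shuf s hs hs' i_1 < shuf s hs hs' (Fin.castAdd e i) then (1 : ℤˣ) else -1) else 1)
      = 1 := by
    refine Finset.prod_eq_one fun i _ => ?_
    rw [Fin.prod_univ_add, Finset.prod_eq_one, Finset.prod_eq_one, one_mul]
    · intro j _
      rw [if_neg]
      simp [Fin.lt_def]
      omega
    · intro j _
      split_ifs with h1 h2
      · rfl
      · exfalso; apply h2
        rw [shuf_castAdd, shuf_castAdd, OrderEmbedding.lt_iff_lt]
        simpa only [Fin.lt_def, Fin.val_castAdd] using h1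
      · rfl
  rw [hA, one_mul]
  refine Finset.prod_congr rfl fun j _ => ?_
  rw [Fin.prod_univ_add]
  have hB : ∏ i : Fin e, (if Fin.natAdd d i < Fin.natAdd d j then
      (if shuf s hs hs' (Fin.natAdd d i) < shuf s hs hs' (Fin.natAdd d j)
        then (1 : ℤˣ) else -1) else 1) = 1 := by
    refine Finset.prod_eq_one fun i _ => ?_
    split_ifs with h1 h2
    · rfl
    · exfalso; apply h2
      rw [shuf_natAdd, shuf_natAdd, OrderEmbedding.lt_iff_lt]
      simpa only [Fin.lt_def, Fin.val_natAdd, Nat.add_lt_add_iff_left] using h1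
    · rfl
  rw [hB, mul_one]
  refine Finset.prod_congr rfl fun i _ => ?_
  rw [if_pos (by simp [Fin.lt_def]; omega), shuf_castAdd, shuf_natAdd]

lemma exists_ext {d n : ℕ} (A : Matrix (Fin d) (Fin n) ℝ) (hA : A.rank = d) :
    ∃ e, n = d + e ∧ ∃ b : Module.Basis (Fin d ⊕ Fin e) ℝ (Fin n → ℝ),
      ∀ i, b (Sum.inl i) = A i := by
  have hli : LinearIndependent ℝ A.row := by
    rw [linearIndependent_iff_card_eq_finrank_span]
    rw [Matrix.rank_eq_finrank_span_row] at hA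
    simpa [Set.finrank] using hA.symm
  let b := Module.Basis.sumExtend hli
  have hb : ∀ i, b (Sum.inl i) = A i := by
    intro i
    simp [b, Module.Basis.sumExtend]
    rfl
  haveI : Finite (Fin d ⊕ Module.Basis.sumExtendIndex hli) := Module.Finite.finite_basis b
  haveI : Finite (Module.Basis.sumExtendIndex hli) := Finite.sum_right (Fin d)
  haveI := Fintype.ofFinite (Module.Basis.sumExtendIndex hli)
  let φ := Fintype.equivFin (Module.Basis.sumExtendIndex hli)
  refine ⟨_, ?_, b.reindex (Equiv.sumCongr (Equiv.refl _) φ), ?_⟩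
  · have := Module.finrank_eq_card_basis b
    simpa using this
  · intro i
    simp [hb]

/-- complementary minors -/
lemma exists_dual {d e : ℕ} (A : Matrix (Fin d) (Fin (d + e)) ℝ)
    (b : Module.Basis (Fin d ⊕ Fin e) ℝ (Fin (d + e) → ℝ)) (hb : ∀ i, b (Sum.inl i) = A i) :
    ∃ (C : Matrix (Fin e) (Fin (d + e)) ℝ) (k : ℝ), k ≠ 0 ∧ C.rank = e ∧
      ∀ (s : Finset (Fin (d + e))) (hs : s.card = d) (hs' : sᶜ.card = e),
        (C.submatrix id (sᶜ.orderEmbOfFin hs')).det =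
          k * (A.submatrix id (s.orderEmbOfFin hs)).det := by
  obtain ⟨c, hc⟩ := sign_shuf d e
  let P : Matrix (Fin d ⊕ Fin e) (Fin d ⊕ Fin e) ℝ := fun i j => b i (finSumFinEquiv j)
  have hP : IsUnit P := by
    rw [← Matrix.linearIndependent_rows_iff_isUnit]
    have := b.linearIndependent.map' (LinearEquiv.funCongrLeft ℝ ℝ
      (finSumFinEquiv (m := d) (n := e))).toLinearMap (LinearEquiv.ker _)
    exact this
  have hdet : IsUnit P.det := (Matrix.isUnit_iff_isUnit_det _).1 hP
  have hdet0 : P.det ≠ 0 := hdet.ne_zero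
  let C0 : Matrix (Fin e) (Fin (d + e)) ℝ := fun i x => P⁻¹ (finSumFinEquiv.symm x) (Sum.inr i)
  let D : Matrix (Fin (d + e)) (Fin (d + e)) ℝ := Matrix.diagonal fun x => (-1) ^ (x : ℕ)
  have hc0 : ((c : ℤ) : ℝ) ≠ 0 := by
    exact_mod_cast c.ne_zero
  refine ⟨C0 * D, ((c : ℤ) : ℝ) * P.det⁻¹, mul_ne_zero hc0 (inv_ne_zero hdet0), ?_, ?_⟩
  · rw [Matrix.rank_mul_eq_left_of_det_ne_zero]
    · have : LinearIndependent ℝ C0.row := by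
        have h1 : LinearIndependent ℝ (P⁻¹).col := by
          rw [Matrix.linearIndependent_cols_iff_isUnit]
          exact (Matrix.isUnit_nonsing_inv_iff).2 hP
        have h2 := h1.comp (Sum.inr : Fin e → Fin d ⊕ Fin e) Sum.inr_injective
        exact h2.map' (LinearEquiv.funCongrLeft ℝ ℝ
          (finSumFinEquiv (m := d) (n := e)).symm).toLinearMap (LinearEquiv.ker _)
      simpa using this.rank_matrix
    · simp [D, Matrix.det_diagonal, Finset.prod_ne_zero_iff]
  · intro s hs hs'
    let σ := finSumEquivOfFinset hs hs'
    let π : Equiv.Perm (Fin d ⊕ Fin e) := σ.trans finSumFinEquiv.symm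
    have hsign : Equiv.Perm.sign π = Equiv.Perm.sign (shuf s hs hs') := by
      have : shuf s hs hs' = (finSumFinEquiv.symm.trans π).trans finSumFinEquiv := by
        ext x; simp [shuf, π, σ]
      rw [this, Equiv.Perm.sign_symm_trans_trans]
    let P' := P.submatrix id π
    let Q' := (P⁻¹).submatrix π id
    have hPQ : P' * Q' = 1 := by
      simp only [P', Q']
      rw [Matrix.submatrix_mul_equiv, Matrix.mul_nonsing_inv _ hdet]
      simp
    have hdetP' : P'.det = ((Equiv.Perm.sign π : ℤ) : ℝ) * P.det := by
      simp only [P']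
      rw [Matrix.det_permute']
    have hmul : P' * Matrix.fromBlocks 1 Q'.toBlocks₁₂ 0 Q'.toBlocks₂₂ =
        Matrix.fromBlocks P'.toBlocks₁₁ 0 P'.toBlocks₂₁ 1 := by
      have e1 := Matrix.fromBlocks_toBlocks P'
      have e2 := Matrix.fromBlocks_toBlocks Q'
      rw [← e1, ← e2, ← Matrix.fromBlocks_one, Matrix.fromBlocks_multiply,
        Matrix.fromBlocks_inj] at hPQ
      conv_lhs => rw [← e1]
      rw [Matrix.fromBlocks_multiply, hPQ.2.1, hPQ.2.2.2]
      simp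
    have hd := congrArg Matrix.det hmul
    rw [Matrix.det_mul, Matrix.det_fromBlocks_zero₂₁, Matrix.det_fromBlocks_zero₁₂,
      Matrix.det_one, Matrix.det_one, one_mul, mul_one, hdetP', hsign, hc s hs hs'] at hd
    have hA : P'.toBlocks₁₁ = A.submatrix id (s.orderEmbOfFin hs) := by
      ext i j
      change b (Sum.inl i) (finSumFinEquiv (finSumFinEquiv.symm (σ (Sum.inl j)))) = _
      rw [hb, Equiv.apply_symm_apply]
      rfl
    have hC : (C0 * D).submatrix id (sᶜ.orderEmbOfFin hs') =
        Matrix.transpose Q'.toBlocks₂₂ * Matrix.diagonal fun j => (-1) ^ (sᶜ.orderEmbOfFin hs' j : ℕ) := by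
      ext i j
      rw [Matrix.mul_diagonal, Matrix.submatrix_apply]
      simp only [D]
      rw [Matrix.mul_diagonal]
      rfl
    rw [hC, Matrix.det_mul, Matrix.det_transpose, Matrix.det_diagonal, ← hA, ← hd]
    push_cast
    have hcc : ((c : ℤ) : ℝ) * ((c : ℤ) : ℝ) = 1 := by
      have := Int.units_mul_self c
      have h2 : (c : ℤ) * (c : ℤ) = 1 := congrArg Units.val this
      exact_mod_cast h2
    field_simp
    rw [pow_two, hcc]
    ring

lemma exists_dual_pos {d e : ℕ} (A : Matrix (Fin d) (Fin (d + e)) ℝ)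
    (b : Module.Basis (Fin d ⊕ Fin e) ℝ (Fin (d + e) → ℝ)) (hb : ∀ i, b (Sum.inl i) = A i) :
    ∃ (C : Matrix (Fin e) (Fin (d + e)) ℝ) (k : ℝ), k ≠ 0 ∧ (0 < k ∨ e = 0) ∧ C.rank = e ∧
      ∀ (s : Finset (Fin (d + e))) (hs : s.card = d) (hs' : sᶜ.card = e),
        (C.submatrix id (sᶜ.orderEmbOfFin hs')).det =
          k * (A.submatrix id (s.orderEmbOfFin hs)).det := by
  obtain ⟨C, k, hk, hr, h⟩ := exists_dual A b hb
  rcases Nat.eq_zero_or_pos e with he | he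
  · exact ⟨C, k, hk, Or.inr he, hr, h⟩
  · let D : Matrix (Fin e) (Fin e) ℝ :=
      Matrix.diagonal (Function.update (fun _ => 1) ⟨0, he⟩ k)
    have hD : D.det = k := by
      simp only [D, Matrix.det_diagonal]
      rw [Finset.prod_update_of_mem (Finset.mem_univ _)]
      simp
    refine ⟨D * C, k * k, mul_ne_zero hk hk, Or.inl (mul_self_pos.2 hk), ?_, ?_⟩
    · rw [Matrix.rank_mul_eq_right_of_det_ne_zero _ _ (by rw [hD]; exact hk), hr]
    · intro s hs hs'
      have : (D * C).submatrix id (sᶜ.orderEmbOfFin hs') =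
          D * C.submatrix id (sᶜ.orderEmbOfFin hs') := by
        ext i j; simp [Matrix.mul_apply]
      rw [this, Matrix.det_mul, hD, h s hs hs', mul_assoc]

lemma li_iff {d n : ℕ} (A : Matrix (Fin d) (Fin n) ℝ) (B : Finset (Fin n)) (hB : B.card = d) :
    LinearIndependent ℝ (fun j : B => fun i => A i j.1) ↔
      (A.submatrix id (B.orderEmbOfFin hB)).det ≠ 0 := by
  rw [← isUnit_iff_ne_zero, ← Matrix.isUnit_iff_isUnit_det,
    ← Matrix.linearIndependent_cols_iff_isUnit,
    ← linearIndependent_equiv (B.orderIsoOfFin hB).toEquiv]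
  rfl

end PosDual

/-- If `M` is a positroid on `[n]`, then the dual matroid `M*`,
whose bases are exactly the complements of the bases of `M`, is also a positroid
on `[n]`. -/
theorem dual_of_positroid_isPositroid (n : ℕ) (ℬ : Finset (Fin n) → Prop)
    (hM : IsPositroid ℬ) :
    IsPositroid (fun B : Finset (Fin n) => ℬ Bᶜ) := by
  obtain ⟨d, A, ⟨hAr, hA⟩, hB⟩ := hM
  obtain ⟨e, rfl, b, hb⟩ := PosDual.exists_ext A hAr
  obtain ⟨C, k, hk, hk', hr, h⟩ := PosDual.exists_dual_pos A b hb
  have hcard : ∀ T : Finset (Fin (d + e)), Tᶜ.card = d ↔ T.card = e := by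
    intro T
    have := Finset.card_add_card_compl T
    rw [Fintype.card_fin] at this
    omega
  have key : ∀ (T : Finset (Fin (d + e))) (hT : T.card = e) (hT' : Tᶜ.card = d),
      (C.submatrix id (T.orderEmbOfFin hT)).det =
        k * (A.submatrix id (Tᶜ.orderEmbOfFin hT')).det := by
    intro T hT hT'
    have := h Tᶜ hT' (by rw [compl_compl]; exact hT)
    simpa only [compl_compl] using this
  refine ⟨e, C, ⟨hr, ?_⟩, ?_⟩
  · intro g hg
    rcases hk' with hk' | rfl
    · have hT : (Finset.univ.image g).card = e := by
        rw [Finset.card_image_of_injective _ hg.injective]; simp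
      have hge := Finset.orderEmbOfFin_unique hT (f := g) (by simp) hg
      rw [hge, key _ hT ((hcard _).2 hT)]
      exact mul_nonneg hk'.le (hA _ (OrderEmbedding.strictMono _))
    · simp
  · intro T
    show ℬ Tᶜ ↔ _
    rw [hB, hcard]
    refine and_congr_right fun hT => ?_
    rw [PosDual.li_iff A _ ((hcard T).2 hT), PosDual.li_iff C _ hT, key T hT ((hcard T).2 hT)]
    simp [hk]
end

section
/- Let M be a positroid on [n] and let S ⊆ [n]. Then the restriction M|S (the matroid on S whose independent sets are the independent sets of M contained in S) is a positroid on S, and the contraction M/S (the matroid on [n] − S whose bases are the sets B − S for bases B of M with |B ∩ S| maximal) is a positroid on [n] − S, where S and [n] − S carry the total order inherited from [n]. -/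
open Finset

theorem pos_indep_ker {E V W : Type*} [AddCommGroup V] [Module ℝ V] [AddCommGroup W] [Module ℝ W]
    (v : E → V) (π : V →ₗ[ℝ] W) (e : E) (he : v e ≠ 0) (hπ : LinearMap.ker π = Submodule.span ℝ {v e})
    (C : Set E) (hC : e ∉ C) :
    LinearIndepOn ℝ (fun j => π (v j)) C ↔ LinearIndepOn ℝ v (insert e C) := by
  have hd : Disjoint {e} C := by simpa using hC
  have h1 := linearIndepOn_union_iff_quotient (R := ℝ) (f := v) hd
  rw [Set.singleton_union] at h1
  rw [h1, and_iff_right (LinearIndepOn.singleton he), Set.image_singleton, ← hπ]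
  have := LinearMap.linearIndependent_iff (v := fun j : C => (LinearMap.ker π).mkQ (v j))
    ((LinearMap.ker π).liftQ π le_rfl) (Submodule.ker_liftQ_eq_bot' _ _ rfl)
  exact this

theorem pos_det_insert {d : ℕ} {E : Type*} [LinearOrder E] (Q : Matrix (Fin (d+1)) E ℝ) (e : E)
    (he : ∀ i, Q i e = Pi.single (M := fun _ => ℝ) 0 1 i) (f : Fin d → E) (p : Fin (d+1)) :
    (Q.submatrix id (p.insertNth e f : Fin (d+1) → E)).det = (-1) ^ (p : ℕ) * (Q.submatrix Fin.succ f).det := by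
  rw [Matrix.det_succ_column _ p, Finset.sum_eq_single 0]
  · have : (Q.submatrix id (p.insertNth e f : Fin (d+1) → E)).submatrix (Fin.succAbove 0) p.succAbove
      = Q.submatrix Fin.succ f := by
      ext i j; simp
    rw [this]; simp [he]
  · intro i _ hi
    simp [he, hi]
  · simp

theorem pos_insert_sorted {d : ℕ} {E : Type*} [LinearOrder E] (e : E) (f : Fin d → E) (hf : StrictMono f)
    (he : ∀ i, f i ≠ e) : ∃ p : Fin (d+1), StrictMono (p.insertNth e f : Fin (d+1) → E) ∧
      ∏ i, (if f i < e then (-1:ℝ) else 1) = (-1) ^ (p : ℕ) := by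
  have hlt : (univ.filter (fun i => f i < e)).card < d + 1 :=
    Nat.lt_succ_of_le ((Finset.card_le_univ _).trans (by simp))
  have key : ∀ i : Fin d, f i < e ↔ (i : ℕ) < (univ.filter (fun i => f i < e)).card := by
    intro i
    constructor
    · intro h
      have : Finset.Iic i ⊆ univ.filter (fun i => f i < e) := by
        intro j hj
        simp only [Finset.mem_Iic] at hj
        simpa using (hf.monotone hj).trans_lt h
      have := Finset.card_le_card this
      rw [Fin.card_Iic] at this
      omega
    · intro h
      by_contra hn
      have : univ.filter (fun i => f i < e) ⊆ Finset.Iio i := by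
        intro j hj
        simp only [Finset.mem_filter, Finset.mem_univ, true_and] at hj
        rw [Finset.mem_Iio]
        by_contra hij
        exact hn ((hf.monotone (not_lt.1 hij)).trans_lt hj)
      have := Finset.card_le_card this
      rw [Fin.card_Iio] at this
      omega
  refine ⟨⟨_, hlt⟩, ?_, ?_⟩
  · rw [Fin.strictMono_insertNth_iff]
    refine ⟨hf, fun i hi => (key i).2 hi, fun i hi => ?_⟩
    refine lt_of_le_of_ne (not_lt.1 fun h => ?_) (he i).symm
    have := (key i).1 h
    have h2 : (univ.filter (fun i => f i < e)).card ≤ (i : ℕ) := hi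
    omega
  · rw [Finset.prod_ite]; simp

/-- Contracting a single nonzero column. -/
theorem pos_step {d : ℕ} {E : Type*} [LinearOrder E] (A : Matrix (Fin (d+1)) E ℝ) (s : ℝ) (hs : s ≠ 0)
    (hA : ∀ f : Fin (d+1) → E, StrictMono f → 0 ≤ s * (A.submatrix id f).det)
    (e : E) (he : (fun i => A i e) ≠ 0) :
    ∃ (A' : Matrix (Fin d) E ℝ) (s' : ℝ), s' ≠ 0 ∧
      (∀ f : Fin d → E, StrictMono f → 0 ≤ s' * (A'.submatrix id f).det) ∧
      ∀ C : Set E, e ∉ C → (LinearIndepOn ℝ (fun j i => A' i j) C ↔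
        LinearIndepOn ℝ (fun j i => A i j) (insert e C)) := by
  obtain ⟨G, hG⟩ := SeparatingDual.exists_continuousLinearEquiv_apply_eq (R := ℝ) (x := fun i => A i e)
    (y := (Pi.single 0 1 : Fin (d+1) → ℝ)) he (by intro h; simpa using congrFun h 0)
  have hdet : (LinearMap.toMatrix' (G.toLinearEquiv : (Fin (d+1) → ℝ) →ₗ[ℝ] (Fin (d+1) → ℝ))).det ≠ 0 := by
    rw [LinearMap.det_toMatrix']
    exact (LinearEquiv.isUnit_det' G.toLinearEquiv).ne_zero
  set g := LinearMap.toMatrix' (G.toLinearEquiv : (Fin (d+1) → ℝ) →ₗ[ℝ] (Fin (d+1) → ℝ)) with hg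
  have hQ : ∀ i j, (g * A) i j = G (fun i => A i j) i := by
    intro i j
    have : G (fun i => A i j) = g.mulVec (fun i => A i j) := by
      rw [hg, LinearMap.toMatrix'_mulVec]; rfl
    rw [this]; rfl
  set ε : E → ℝ := fun j => if j < e then (-1:ℝ) else 1 with hε
  have hε0 : ∀ j, ε j ≠ 0 := by intro j; simp only [hε]; split_ifs <;> norm_num
  have hQe : ∀ i, (g * A) i e = Pi.single (M := fun _ => ℝ) 0 1 i := by
    intro i; rw [hQ, hG]
  refine ⟨Matrix.of fun i j => ε j * (g * A) i.succ j, s / g.det, div_ne_zero hs hdet, ?_, ?_⟩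
  · intro f hf
    have h1 : ((Matrix.of fun i j => ε j * (g * A) i.succ j).submatrix id f).det
        = (∏ i, ε (f i)) * ((g * A).submatrix Fin.succ f).det := 
      Matrix.det_mul_row (fun i => ε (f i)) ((g * A).submatrix Fin.succ f)
    rw [h1]
    by_cases hef : ∀ i, f i ≠ e
    · obtain ⟨p, hp, hp2⟩ := pos_insert_sorted e f hf hef
      have h2 := pos_det_insert (g * A) e hQe f p
      rw [show (∏ i, ε (f i)) = (-1) ^ (p : ℕ) from hp2, ← h2]
      have h3 : ((g * A).submatrix id (p.insertNth e f : Fin (d+1) → E)) =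
        g * (A.submatrix id (p.insertNth e f : Fin (d+1) → E)) := by
        ext i j; rfl
      rw [h3, Matrix.det_mul]
      have := hA _ hp
      rw [show s / g.det * (g.det * (A.submatrix id (p.insertNth e f : Fin (d+1) → E)).det) =
        s * (A.submatrix id (p.insertNth e f : Fin (d+1) → E)).det by field_simp]
      exact this
    · push Not at hef
      obtain ⟨i, hi⟩ := hef
      rw [Matrix.det_eq_zero_of_column_eq_zero i]
      · simp
      · intro j; simp only [Matrix.submatrix_apply, hi]; rw [hQe]; simp
  · intro C hC
    let π : (Fin (d+1) → ℝ) →ₗ[ℝ] (Fin d → ℝ) :=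
      (LinearMap.funLeft ℝ ℝ Fin.succ) ∘ₗ (G.toLinearEquiv : (Fin (d+1) → ℝ) →ₗ[ℝ] (Fin (d+1) → ℝ))
    have hπ : ∀ x i, π x i = G x (Fin.succ i) := fun x i => rfl
    rw [← pos_indep_ker (fun j i => A i j) π e he _ C hC]
    · have := LinearIndependent.units_smul_iff (R := ℝ) (v := fun j : C => π (fun i => A i j))
        (w := fun j => Units.mk0 (ε j) (hε0 j))
      refine Iff.trans (iff_of_eq ?_) this
      show LinearIndependent ℝ _ = LinearIndependent ℝ _
      congr 1
      funext j i
      show ε j * (g * A) i.succ j = ε j * (π (fun i => A i j) i)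
      rw [hπ, hQ]
    · ext x
      rw [LinearMap.mem_ker, Submodule.mem_span_singleton]
      constructor
      · intro h
        refine ⟨G x 0, G.injective ?_⟩
        rw [map_smul, hG]
        funext i
        refine Fin.cases ?_ (fun i => ?_) i
        · simp
        · have := congrFun h i
          rw [hπ] at this
          simp [this]
      · rintro ⟨a, rfl⟩
        funext i
        rw [hπ, map_smul, hG]
        simp

/-- Contracting an independent set of columns. -/
theorem pos_contract {E : Type*} [LinearOrder E] (T : Finset E) : ∀ {k d : ℕ} (_ : d = k + T.card)
    (A : Matrix (Fin d) E ℝ) (s : ℝ) (_ : s ≠ 0)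
    (_ : ∀ f : Fin d → E, StrictMono f → 0 ≤ s * (A.submatrix id f).det)
    (_ : LinearIndepOn ℝ (fun j i => A i j) (T : Set E)),
    ∃ (A' : Matrix (Fin k) E ℝ) (s' : ℝ), s' ≠ 0 ∧
      (∀ f : Fin k → E, StrictMono f → 0 ≤ s' * (A'.submatrix id f).det) ∧
      ∀ C : Set E, Disjoint C T → (LinearIndepOn ℝ (fun j i => A' i j) C ↔
        LinearIndepOn ℝ (fun j i => A i j) (C ∪ T)) := by
  induction T using Finset.induction_on with
  | empty =>
    intro k d hd A s hs hA hT
    obtain rfl : d = k := by simpa using hd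
    exact ⟨A, s, hs, hA, fun C _ => by simp⟩
  | insert e T heT ih =>
    intro k d hd A s hs hA hT
    rw [Finset.card_insert_of_notMem heT] at hd
    obtain ⟨A1, s1, hs1, hA1, h1⟩ := ih (k := k + 1) (by omega) A s hs hA
      (hT.mono (by simp))
    have he : LinearIndepOn ℝ (fun j i => A1 i j) {e} := by
      rw [h1 _ (by simpa using heT)]
      simpa using hT
    obtain ⟨A2, s2, hs2, hA2, h2⟩ := pos_step A1 s1 hs1 hA1 e
      (he.ne_zero (Set.mem_singleton e))
    refine ⟨A2, s2, hs2, hA2, fun C hC => ?_⟩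
    rw [Finset.coe_insert, Set.disjoint_insert_right] at hC
    rw [h2 C hC.1, h1 _ (by rw [Set.disjoint_insert_left]; exact ⟨by simpa using heT, hC.2⟩),
      Finset.coe_insert, Set.union_insert, Set.insert_union]

/-- The family of `C ⊆ U` with `C ∪ T` a basis is a positroid if nonempty. -/
theorem pos_minor {E : Type*} [LinearOrder E] (P : E → Prop) [Fintype {x // P x}] (T : Finset E) (hPT : ∀ x ∈ T, ¬ P x) {k d : ℕ}
    (hd : d = k + T.card) (A : Matrix (Fin d) E ℝ) 
    (hA : ∀ f : Fin d → E, StrictMono f → 0 ≤ (A.submatrix id f).det)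
    (ℬ : Finset {x // P x} → Prop)
    (hB : ∀ C, ℬ C ↔ C.card = k ∧ LinearIndepOn ℝ (fun j i => A i j)
      (((C.map (Function.Embedding.subtype P) : Finset E) : Set E) ∪ T))
    (hne : ∃ C, ℬ C) : IsPositroid ℬ := by
  obtain ⟨C0, hC0⟩ := hne
  have hC0' := (hB _).1 hC0
  obtain ⟨A1, s, hs, hA1, h1⟩ := pos_contract T hd A 1 one_ne_zero (by simpa using hA)
    (hC0'.2.mono Set.subset_union_right)
  have h2 : ∃ A2 : Matrix (Fin k) E ℝ, (∀ f : Fin k → E, StrictMono f → 0 ≤ (A2.submatrix id f).det) ∧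
      ∀ C : Set E, (LinearIndepOn ℝ (fun j i => A2 i j) C ↔ LinearIndepOn ℝ (fun j i => A1 i j) C) := by
    cases k with
    | zero => exact ⟨A1, fun f _ => by simp, fun _ => Iff.rfl⟩
    | succ k =>
      let D : Fin (k+1) → ℝ := Fin.cons s (fun _ => 1)
      have hD : ∀ i, D i ≠ 0 := by
        intro i; refine Fin.cases ?_ (fun i => ?_) i <;> simp [D, hs]
      refine ⟨Matrix.of fun i j => D i * A1 i j, fun f hf => ?_, fun C => ?_⟩
      · have : ((Matrix.of fun i j => D i * A1 i j).submatrix id f).det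
          = (∏ i, D i) * (A1.submatrix id f).det := Matrix.det_mul_column D (A1.submatrix id f)
        rw [this, Fin.prod_univ_succ]
        simpa [D] using hA1 f hf
      · let L : (Fin (k+1) → ℝ) →ₗ[ℝ] (Fin (k+1) → ℝ) := 
          LinearMap.pi fun i => D i • LinearMap.proj i
        refine LinearMap.linearIndependent_iff (v := fun (j : C) i => A1 i j) L ?_
        rw [LinearMap.ker_eq_bot']
        intro x hx
        funext i
        have := congrFun hx i
        simpa [L, hD] using this
  obtain ⟨A2, hA2, h2⟩ := h2
  have hrep : ∀ C : Finset {x // P x}, LinearIndependent ℝ (fun j : C => fun i => A2 i j.1.1) ↔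
      LinearIndepOn ℝ (fun j i => A i j)
      (((C.map (Function.Embedding.subtype P) : Finset E) : Set E) ∪ T) := by
    intro C
    have hdis : Disjoint (((C.map (Function.Embedding.subtype P) : Finset E) : Set E)) (T : Set E) := by
      rw [Finset.disjoint_coe, Finset.disjoint_left]
      intro x hx hxT
      simp only [Finset.mem_map, Function.Embedding.subtype_apply] at hx
      obtain ⟨y, -, rfl⟩ := hx
      exact hPT _ hxT y.2
    rw [← h1 _ hdis, ← h2, Finset.coe_map]
    constructor
    · intro h
      exact LinearIndepOn.image_of_comp (s := (C : Set {x // P x})) (Function.Embedding.subtype P) (fun j i => A2 i j) h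
    · intro h
      have h' := LinearIndepOn.comp_of_image (R := ℝ) (s := (C : Set {x // P x}))
        (f := (Function.Embedding.subtype P : {x // P x} → E)) (v := fun j i => A2 i j) h
        (Function.Embedding.injective _).injOn
      exact h'
  refine ⟨k, A2.submatrix id Subtype.val, ⟨?_, ?_⟩, ?_⟩
  · apply le_antisymm
    · have h5 := Matrix.rank_le_card_height (A2.submatrix id (Subtype.val : {x // P x} → E))
      rw [Fintype.card_fin] at h5
      exact h5
    · have hli := (hrep C0).2 hC0'.2
      rw [Matrix.rank_eq_finrank_span_cols]
      have h3 := finrank_span_eq_card hli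
      rw [Fintype.card_coe, hC0'.1] at h3
      refine h3.symm.le.trans ?_
      apply Submodule.finrank_mono
      apply Submodule.span_mono
      rintro _ ⟨j, rfl⟩
      exact ⟨j.1, rfl⟩
  · intro f hf
    exact hA2 (fun i => (f i).1) (fun a b hab => hf hab)
  · intro C
    rw [hB]
    exact and_congr_right fun _ => (hrep C).symm

theorem pos_finrank {E V : Type*} [AddCommGroup V] [Module ℝ V] (v : E → V) (X : Finset E)
    (hX : LinearIndepOn ℝ v (X : Set E)) :
    Module.finrank ℝ (Submodule.span ℝ (v '' (X : Set E))) = X.card := by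
  have h := finrank_span_eq_card (b := fun j : X => v j) hX
  rw [Fintype.card_coe] at h
  rw [← h, Set.image_eq_range]
  rfl

theorem pos_ext {E V : Type*} [AddCommGroup V] [Module ℝ V] (v : E → V) (X S : Finset E)
    (hX : LinearIndepOn ℝ v (X : Set E)) (hXS : X ⊆ S) :
    ∃ B : Finset E, B ⊆ S ∧ X ⊆ B ∧
      Submodule.span ℝ (v '' (B : Set E)) = Submodule.span ℝ (v '' (S : Set E)) ∧
      LinearIndepOn ℝ v (B : Set E) := by
  obtain ⟨b, hbS, hXb, hsp, hb⟩ := exists_linearIndepOn_extension hX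
    (show (X : Set E) ⊆ (S : Set E) by exact_mod_cast hXS)
  obtain ⟨B, rfl⟩ := (S.finite_toSet.subset hbS).exists_finset_coe
  refine ⟨B, by exact_mod_cast hbS, by exact_mod_cast hXb, le_antisymm ?_ ?_, hb⟩
  · exact Submodule.span_mono (Set.image_mono hbS)
  · exact Submodule.span_le.2 hsp

/-- Let `M` be a positroid on `[n]` and `S ⊆ [n]`.  Then the
restriction `M|S` — the matroid on `S` (with the inherited total order) whose
independent sets are the independent sets of `M` contained in `S`, so whose
bases are the maximal subsets of `S` contained in a basis of `M` — is a
positroid on `S`; and the contraction `M/S` — the matroid on `[n] - S` (with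
the inherited total order) whose bases are the sets `B - S` for bases `B` of
`M` with `|B ∩ S|` maximal — is a positroid on `[n] - S`. -/
theorem restriction_contraction_of_positroid (n : ℕ) (ℬ : Finset (Fin n) → Prop)
    (hM : IsPositroid ℬ) (S : Finset (Fin n)) :
    IsPositroid (fun C : Finset {x : Fin n // x ∈ S} =>
      (∃ B, ℬ B ∧ C.map (Function.Embedding.subtype fun x => x ∈ S) ⊆ B) ∧
      ∀ C' : Finset {x : Fin n // x ∈ S},
        (∃ B, ℬ B ∧ C'.map (Function.Embedding.subtype fun x => x ∈ S) ⊆ B) →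
          C ⊆ C' → C = C') ∧
    IsPositroid (fun C : Finset {x : Fin n // x ∉ S} =>
      ∃ B, ℬ B ∧ (∀ B', ℬ B' → (B' ∩ S).card ≤ (B ∩ S).card) ∧
        C.map (Function.Embedding.subtype fun x => x ∉ S) = B \ S) := by
  classical
  obtain ⟨d, A, ⟨hrank, hA⟩, hrep⟩ := hM
  set v : Fin n → (Fin d → ℝ) := fun j i => A i j with hv
  have hB : ∀ B, ℬ B ↔ B.card = d ∧ LinearIndepOn ℝ v (B : Set (Fin n)) := hrep
  have hext : ∀ X : Finset (Fin n), LinearIndepOn ℝ v (X : Set (Fin n)) → ∃ B, ℬ B ∧ X ⊆ B := by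
    intro X hX
    obtain ⟨B, -, hXB, hsp, hind⟩ := pos_ext v X univ hX (Finset.subset_univ _)
    refine ⟨B, (hB B).2 ⟨?_, hind⟩, hXB⟩
    rw [← pos_finrank v B hind, hsp]
    refine Eq.trans ?_ hrank
    rw [Matrix.rank_eq_finrank_span_cols, Finset.coe_univ, Set.image_univ]
    rfl
  obtain ⟨I, hIS, -, hIsp, hI⟩ := pos_ext v ∅ S (by simp) (Finset.empty_subset _)
  obtain ⟨B0, hB0, hIB0⟩ := hext I hI
  have hB0' := (hB B0).1 hB0
  have hle : ∀ X : Finset (Fin n), X ⊆ S → LinearIndepOn ℝ v (X : Set (Fin n)) → X.card ≤ I.card := by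
    intro X hXS hX
    rw [← pos_finrank v X hX, ← pos_finrank v I hI, hIsp]
    exact Submodule.finrank_mono (Submodule.span_mono (Set.image_mono (by exact_mod_cast hXS)))
  have hspan : ∀ X : Finset (Fin n), X ⊆ S → LinearIndepOn ℝ v (X : Set (Fin n)) → X.card = I.card →
      Submodule.span ℝ (v '' (X : Set (Fin n))) = Submodule.span ℝ (v '' (I : Set (Fin n))) := by
    intro X hXS hX hc
    rw [hIsp]
    refine Submodule.eq_of_le_of_finrank_eq
      (Submodule.span_mono (Set.image_mono (by exact_mod_cast hXS))) ?_
    rw [pos_finrank v X hX, ← hIsp, pos_finrank v I hI, hc]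
  have hsd : ∀ X Y : Finset (Fin n), X ⊆ S → Disjoint Y S → Disjoint (X : Set (Fin n)) (Y : Set (Fin n)) := by
    intro X Y hX hY
    rw [Finset.disjoint_coe]
    exact (hY.mono_right hX).symm
  have hexch : ∀ X X' Y : Finset (Fin n), X ⊆ S → X' ⊆ S → Disjoint Y S →
      LinearIndepOn ℝ v (X' : Set (Fin n)) → X.card = I.card → X'.card = I.card →
      LinearIndepOn ℝ v ((X : Set (Fin n)) ∪ Y) → LinearIndepOn ℝ v ((X' : Set (Fin n)) ∪ Y) := by
    intro X X' Y hX hX' hY hi hc hc' h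
    rw [linearIndepOn_union_iff (hsd X Y hX hY)] at h
    rw [linearIndepOn_union_iff (hsd X' Y hX' hY)]
    refine ⟨hi, h.2.1, ?_⟩
    rw [hspan X' hX' hi hc', ← hspan X hX h.1 hc]
    exact h.2.2
  have hB0S : B0 ∩ S = I := by
    refine (Finset.eq_of_subset_of_card_le (Finset.subset_inter hIB0 hIS) ?_).symm
    exact hle _ Finset.inter_subset_right (hB0'.2.mono (by simp))
  have hdT : Disjoint (B0 \ S) S := Finset.sdiff_disjoint
  have hcardT : d = I.card + (B0 \ S).card := by
    rw [← hB0'.1, ← hB0S, Finset.card_inter_add_card_sdiff]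
  have hIT : LinearIndepOn ℝ v ((I : Set (Fin n)) ∪ ((B0 \ S : Finset (Fin n)) : Set (Fin n))) := by
    refine hB0'.2.mono ?_
    rw [← Finset.coe_union, Finset.coe_subset]
    exact Finset.union_subset hIB0 Finset.sdiff_subset
  have hmapS : ∀ C : Finset {x : Fin n // x ∈ S},
      C.map (Function.Embedding.subtype fun x => x ∈ S) ⊆ S := by
    intro C x hx
    simp only [Finset.mem_map, Function.Embedding.subtype_apply] at hx
    obtain ⟨y, -, rfl⟩ := hx
    exact y.2
  have hmapS' : ∀ C : Finset {x : Fin n // x ∉ S},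
      Disjoint (C.map (Function.Embedding.subtype fun x => x ∉ S)) S := by
    intro C
    rw [Finset.disjoint_left]
    intro x hx
    simp only [Finset.mem_map, Function.Embedding.subtype_apply] at hx
    obtain ⟨y, -, rfl⟩ := hx
    exact y.2
  have hind : ∀ X : Finset (Fin n), (∃ B, ℬ B ∧ X ⊆ B) ↔ LinearIndepOn ℝ v (X : Set (Fin n)) := by
    intro X
    refine ⟨?_, hext X⟩
    rintro ⟨B, hBB, hXB⟩
    exact ((hB B).1 hBB).2.mono (by exact_mod_cast hXB)
  constructor
  · have hiff : ∀ C : Finset {x : Fin n // x ∈ S},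
        ((∃ B, ℬ B ∧ C.map (Function.Embedding.subtype fun x => x ∈ S) ⊆ B) ∧
        ∀ C' : Finset {x : Fin n // x ∈ S},
        (∃ B, ℬ B ∧ C'.map (Function.Embedding.subtype fun x => x ∈ S) ⊆ B) →
          C ⊆ C' → C = C') ↔ C.card = I.card ∧ LinearIndepOn ℝ v
          (((C.map (Function.Embedding.subtype fun x => x ∈ S) : Finset (Fin n)) : Set (Fin n)) ∪
            ((B0 \ S : Finset (Fin n)) : Set (Fin n))) := by
      intro C
      simp only [hind]
      constructor
      · rintro ⟨hC, hmax⟩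
        obtain ⟨X, hXS, hCX, hsp, hX⟩ := pos_ext v _ S hC (hmapS C)
        have hX' : (X.subtype fun x => x ∈ S).map (Function.Embedding.subtype fun x => x ∈ S) = X :=
          Finset.subtype_map_of_mem fun x hx => hXS hx
        have hCe : C = X.subtype fun x => x ∈ S := by
          apply hmax
          · rw [hX']; exact hX
          · intro y hy
            rw [Finset.mem_subtype]
            exact hCX (Finset.mem_map_of_mem _ hy)
        have hc : C.card = I.card := by
          rw [← Finset.card_map (Function.Embedding.subtype fun x => x ∈ S), hCe, hX',
            ← pos_finrank v X hX, hsp, ← hIsp, pos_finrank v I hI]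
        exact ⟨hc, hexch I _ _ hIS (hmapS C) hdT hC rfl (by rw [Finset.card_map, hc]) hIT⟩
      · rintro ⟨hc, hC⟩
        refine ⟨hC.mono Set.subset_union_left, fun C' hC' hCC' => ?_⟩
        refine Finset.eq_of_subset_of_card_le hCC' ?_
        have := hle _ (hmapS C') hC'
        rw [Finset.card_map] at this
        omega
    refine pos_minor (fun x => x ∈ S) (B0 \ S) (fun x hx => (Finset.mem_sdiff.1 hx).2) hcardT A hA _ hiff
      ⟨I.subtype fun x => x ∈ S, (hiff _).2 ?_⟩
    have hI' : (I.subtype fun x => x ∈ S).map (Function.Embedding.subtype fun x => x ∈ S) = I :=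
      Finset.subtype_map_of_mem fun x hx => hIS hx
    rw [hI', ← Finset.card_map (Function.Embedding.subtype fun x => x ∈ S), hI']
    exact ⟨rfl, hIT⟩
  · have hiff : ∀ C : Finset {x : Fin n // x ∉ S},
        (∃ B, ℬ B ∧ (∀ B', ℬ B' → (B' ∩ S).card ≤ (B ∩ S).card) ∧
        C.map (Function.Embedding.subtype fun x => x ∉ S) = B \ S) ↔
        C.card = (B0 \ S).card ∧ LinearIndepOn ℝ v
          (((C.map (Function.Embedding.subtype fun x => x ∉ S) : Finset (Fin n)) : Set (Fin n)) ∪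
            (I : Set (Fin n))) := by
      intro C
      constructor
      · rintro ⟨B, hBB, hmax, hCB⟩
        have hBB' := (hB B).1 hBB
        have h1 := hmax B0 hB0
        rw [hB0S] at h1
        have hBSi : LinearIndepOn ℝ v ((B ∩ S : Finset (Fin n)) : Set (Fin n)) :=
          hBB'.2.mono (by simp)
        have h2 : (B ∩ S).card = I.card := le_antisymm (hle _ Finset.inter_subset_right hBSi) h1
        have h3 := Finset.card_inter_add_card_sdiff B S
        rw [← Finset.card_map (Function.Embedding.subtype fun x => x ∉ S), hCB]
        refine ⟨by have := hBB'.1; omega, ?_⟩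
        rw [Set.union_comm]
        refine hexch (B ∩ S) I (B \ S) Finset.inter_subset_right hIS Finset.sdiff_disjoint hI h2 rfl ?_
        refine hBB'.2.mono ?_
        rw [← Finset.coe_union, Finset.coe_subset]
        exact Finset.union_subset Finset.inter_subset_left Finset.sdiff_subset
      · rintro ⟨hc, hC⟩
        set X := C.map (Function.Embedding.subtype fun x => x ∉ S) with hX
        have hXS : Disjoint X S := hmapS' C
        have hXc : X.card = C.card := Finset.card_map _
        have e1 : (X ∪ I) ∩ S = I := by
          rw [Finset.union_inter_distrib_right, Finset.disjoint_iff_inter_eq_empty.1 hXS,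
            Finset.empty_union, Finset.inter_eq_left.2 hIS]
        have e2 : (X ∪ I) \ S = X := by
          rw [Finset.union_sdiff_distrib, Finset.sdiff_eq_self_of_disjoint hXS,
            Finset.sdiff_eq_empty_iff_subset.2 hIS, Finset.union_empty]
        refine ⟨X ∪ I, (hB _).2 ⟨?_, by rw [Finset.coe_union]; exact hC⟩, ?_, e2.symm⟩
        · rw [Finset.card_union_of_disjoint (hXS.mono_right hIS)]
          omega
        · intro B' hB'
          rw [e1]
          exact hle _ Finset.inter_subset_right (((hB B').1 hB').2.mono (by simp))
    refine pos_minor (fun x => x ∉ S) I (fun x hx => not_not.2 (hIS hx))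
      (hcardT.trans (add_comm _ _)) A hA _ hiff
      ⟨(B0 \ S).subtype fun x => x ∉ S, B0, hB0, ?_, ?_⟩
    · intro B' hB'
      rw [hB0S]
      exact hle _ Finset.inter_subset_right (((hB B').1 hB').2.mono (by simp))
    · exact Finset.subtype_map_of_mem fun x hx => (Finset.mem_sdiff.1 hx).2
end

section
/- Let M be a rank-d matroid on [n] with Grassmann necklace I(M) = (I_1,...,I_n). Then every basis B of M satisfies I_j ≤_j B in the Gale order with respect to <_j, for every j ∈ [n]; that is, every basis of M belongs to the collection B(I(M)) = { B a d-subset of [n] : B ≥_j I_j for all j ∈ [n] }. -/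
open Finset

/-- The basis-exchange axiom: `ℬ` is the (nonempty) collection of bases of a
matroid on the ground set `E`. -/
def IsBasesSet {E : Type*} [DecidableEq E] (ℬ : Finset E → Prop) : Prop :=
  (∃ B, ℬ B) ∧
  ∀ ⦃B₁ B₂ : Finset E⦄, ℬ B₁ → ℬ B₂ → ∀ b₁ ∈ B₁ \ B₂,
    ∃ b₂ ∈ B₂ \ B₁, ℬ (insert b₂ (B₁.erase b₁))

/-- Lexicographic order on two `d`-element subsets of `Fin n` (with respect to
the standard order): comparing the increasing enumerations `s_1 < ... < s_d`
and `t_1 < ... < t_d`, either they agree or they first differ at an index `k`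
where `s_k < t_k`. -/
def LexLE {n : ℕ} (d : ℕ) (S T : Finset (Fin n)) : Prop :=
  ∃ (hS : S.card = d) (hT : T.card = d),
    S = T ∨ ∃ k : Fin d,
      (∀ l, l < k → ((S.orderIsoOfFin hS) l : Fin n) = ((T.orderIsoOfFin hT) l : Fin n)) ∧
      ((S.orderIsoOfFin hS) k : Fin n) < ((T.orderIsoOfFin hT) k : Fin n)

/-- Gale order on two `d`-element subsets of `Fin n` (with respect to the
standard order): the increasing enumerations satisfy `s_k ≤ t_k` for all `k`. -/
def GaleLE {n : ℕ} (d : ℕ) (S T : Finset (Fin n)) : Prop :=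
  ∃ (hS : S.card = d) (hT : T.card = d),
    ∀ k : Fin d, ((S.orderIsoOfFin hS) k : Fin n) ≤ ((T.orderIsoOfFin hT) k : Fin n)

/-- Augmentation for independent sets, from the basis-exchange axiom. -/
lemma aux_augment {E : Type*} [Fintype E] [DecidableEq E] {ℬ : Finset E → Prop}
    (hmat : IsBasesSet ℬ) {S T I B : Finset E} (hI : ℬ I) (hB : ℬ B)
    (hS : S ⊆ I) (hT : T ⊆ B) (hc : S.card < T.card) :
    ∃ t ∈ T, t ∉ S ∧ ∃ C, ℬ C ∧ insert t S ⊆ C := by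
  classical
  let M : Matroid E := Matroid.ofIsBaseOfFinite (E := Set.univ) Set.finite_univ
    (fun X => ∃ F : Finset E, ℬ F ∧ (F : Set E) = X)
    (by obtain ⟨F, hF⟩ := hmat.1; exact ⟨F, F, hF, rfl⟩)
    (by
      rintro _ _ ⟨F, hF, rfl⟩ ⟨G, hG, rfl⟩ a ha
      obtain ⟨b, hb, h⟩ := hmat.2 hF hG a (by simpa using ha)
      exact ⟨b, by simpa using hb, _, h, by simp⟩)
    (fun _ _ => Set.subset_univ _)
  have key : ∀ F : Finset E, ℬ F → ∀ S ⊆ F, M.Indep (S : Set E) := by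
    intro F hF S hS
    have : M.IsBase (F : Set E) := ⟨F, hF, rfl⟩
    exact this.indep.subset (by exact_mod_cast hS)
  obtain ⟨t, htT, htS, hind⟩ := (key I hI S hS).augment_finset (key B hB T hT) hc
  obtain ⟨X, ⟨C, hC, rfl⟩, hX⟩ := hind.exists_isBase_superset
  exact ⟨t, htT, htS, C, hC, by exact_mod_cast hX⟩

/-- The same, for the image of the collection of bases under an injection. -/
lemma aux_augment_image {E : Type*} [Fintype E] [DecidableEq E] {ℬ : Finset E → Prop}
    (hmat : IsBasesSet ℬ) {f : E → E} (hf : Function.Injective f)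
    {S T I B : Finset E} (hI : ℬ I) (hB : ℬ B)
    (hS : S ⊆ I.image f) (hT : T ⊆ B.image f) (hc : S.card < T.card) :
    ∃ t ∈ T, t ∉ S ∧ ∃ C, ℬ C ∧ insert t S ⊆ C.image f := by
  obtain ⟨S, hS', rfl⟩ := Finset.subset_image_iff.1 hS
  obtain ⟨T, hT', rfl⟩ := Finset.subset_image_iff.1 hT
  rw [card_image_of_injective _ hf, card_image_of_injective _ hf] at hc
  obtain ⟨t, htT, htS, C, hC, h⟩ := aux_augment hmat hI hB (by exact_mod_cast hS')
    (by exact_mod_cast hT') hc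
  refine ⟨f t, mem_image_of_mem _ htT, ?_, C, hC, ?_⟩
  · rwa [hf.mem_finset_image]
  · rw [← image_insert]
    exact image_subset_image h

/-- A set containing the first `k` elements of `I`, and another element `t ∉ I` smaller than
the next element of `I`, is not lexicographically above `I`. -/
lemma aux_not_lex {n d : ℕ} {I C : Finset (Fin n)} (hI : I.card = d) (k : Fin d) (t : Fin n)
    (hsub : ∀ l < k, I.orderEmbOfFin hI l ∈ C) (htC : t ∈ C)
    (htS : ∀ l < k, I.orderEmbOfFin hI l ≠ t) (htk : t < I.orderEmbOfFin hI k) :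
    ¬ LexLE d I C := by
  rintro ⟨_, hC, h⟩
  have htI : t ∉ I := by
    intro h
    rw [← mem_coe, ← range_orderEmbOfFin I hI] at h
    obtain ⟨m, rfl⟩ := h
    exact htS m ((I.orderEmbOfFin hI).lt_iff_lt.1 htk) rfl
  rcases h with rfl | ⟨k', hl, hk'⟩
  · exact htI htC
  simp only [coe_orderIsoOfFin_apply] at hl hk'
  rcases lt_or_ge k' k with hkk | hkk
  · have h := hsub k' hkk
    rw [← mem_coe, ← range_orderEmbOfFin C hC] at h
    obtain ⟨m, hm⟩ := h
    rw [← hm] at hk'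
    have hmk := (C.orderEmbOfFin hC).lt_iff_lt.1 hk'
    have := hl m hmk
    rw [hm] at this
    exact hmk.ne ((I.orderEmbOfFin hI).injective this)
  · have h := htC
    rw [← mem_coe, ← range_orderEmbOfFin C hC] at h
    obtain ⟨m, rfl⟩ := h
    rcases lt_or_ge m k' with hm | hm
    · apply htI
      rw [← hl m hm]
      exact orderEmbOfFin_mem _ _ _
    · have h1 := (C.orderEmbOfFin hC).monotone hm
      have h2 := (I.orderEmbOfFin hI).monotone hkk
      exact absurd (htk.trans_le (h2.trans (hk'.le.trans h1))) (lt_irrefl _)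

/-- Let `M` be a rank-`d` matroid on `[n]` (modeled on `Fin n`,
`j : Fin n` standing for `j+1 ∈ [n]`) with Grassmann necklace
`I(M) = (I_1, ..., I_n)`: here `I j` is the lexicographically minimal basis of
`M` with respect to the `j`-order `<_j` on `[n]`, which we express by shifting
by `j` (the map `x ↦ x - j` is an order isomorphism from `([n], <_j)` to the
standardly ordered `Fin n`).  Then every basis `B` of `M` satisfies
`I_j ≤_j B` in the Gale order with respect to `<_j`, for every `j`. -/
theorem necklace_gale_minimal (n d : ℕ) (ℬ : Finset (Fin n) → Prop)
    (hmat : IsBasesSet ℬ) (hrank : ∀ B, ℬ B → B.card = d)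
    (I : Fin n → Finset (Fin n))
    (hIbase : ∀ j, ℬ (I j))
    (hImin : ∀ j B, ℬ B →
      LexLE d ((I j).image (fun x => x - j)) (B.image (fun x => x - j))) :
    ∀ j B, ℬ B →
      GaleLE d ((I j).image (fun x => x - j)) (B.image (fun x => x - j)) := by
  intro j B hB
  obtain ⟨hI', hB', -⟩ := hImin j B hB
  have hinj : Function.Injective (fun x : Fin n => x - j) := by
    have : NeZero n := ⟨by rintro rfl; exact j.elim0⟩
    exact sub_left_injective
  refine ⟨hI', hB', fun k => ?_⟩
  simp only [coe_orderIsoOfFin_apply]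
  by_contra! hlt
  obtain ⟨t, htT, htS, C, hC, hsub⟩ := aux_augment_image hmat hinj (hIbase j) hB
    (S := (Iio k).image (orderEmbOfFin _ hI')) (T := (Iic k).image (orderEmbOfFin _ hB'))
    (by intro x hx; obtain ⟨l, -, rfl⟩ := mem_image.1 hx; exact orderEmbOfFin_mem _ _ _)
    (by intro x hx; obtain ⟨l, -, rfl⟩ := mem_image.1 hx; exact orderEmbOfFin_mem _ _ _)
    (by
      rw [card_image_of_injective _ (RelEmbedding.injective _),
        card_image_of_injective _ (RelEmbedding.injective _)]
      simp)
  refine aux_not_lex hI' k t ?_ (hsub (mem_insert_self _ _)) ?_ ?_ (hImin j C hC)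
  · intro l hl
    exact hsub (mem_insert_of_mem (mem_image_of_mem _ (mem_Iio.2 hl)))
  · rintro l hl rfl
    exact htS (mem_image_of_mem _ (mem_Iio.2 hl))
  · obtain ⟨l, hl, rfl⟩ := mem_image.1 htT
    exact lt_of_le_of_lt ((orderEmbOfFin _ hB').monotone (mem_Iic.1 hl)) hlt
end

section
/- Let M be a rank-d positroid on [n] with Grassmann necklace (I_1,...,I_n), and for each j ∈ [n] write I_j = {a^j_1 <_j a^j_2 <_j ... <_j a^j_d}. Then the matroid polytope Γ_M equals the set of x ∈ ℝ^n satisfying: x_1 + x_2 + ... + x_n = d; x_j ≥ 0 for all j ∈ [n]; and for all j ∈ [n] and k ∈ [d], the sum of x_ℓ over ℓ in the cyclic interval [j, a^j_k − 1] is at most k − 1, where indices are taken mod n with representatives in {1,...,n} and the cyclic interval is interpreted as empty when a^j_k = j. -/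
open Finset

/-- The matroid (basis) polytope: the convex hull in `ℝ^n` of the indicator
vectors of the bases of the matroid with basis collection `ℬ`. -/
def matroidPolytope {n : ℕ} (ℬ : Finset (Fin n) → Prop) : Set (Fin n → ℝ) :=
  convexHull ℝ {x : Fin n → ℝ | ∃ B, ℬ B ∧ x = fun i => if i ∈ B then (1 : ℝ) else 0}

/-- The half-open cyclic interval `[j, a-1] = {j, j+1, ..., a-1}` in `Fin n`
(cyclically); it is empty when `a = j`. -/
def cycIntTo {n : ℕ} (j a : Fin n) : Finset (Fin n) :=
  Finset.univ.filter fun ℓ => (ℓ - j).val < (a - j).val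


namespace PosPoly

/-- Sign control: a maximal minor with arbitrary column order has the sign of the Vandermonde
determinant of the column labels. -/
theorem det_sign {n d : ℕ} (A : Matrix (Fin d) (Fin n) ℝ)
    (hA : ∀ f : Fin d → Fin n, StrictMono f → 0 ≤ (A.submatrix id f).det)
    (g : Fin d → Fin n) (hg : (A.submatrix id g).det ≠ 0) :
    0 < (A.submatrix id g).det * (Matrix.vandermonde (fun k => ((g k).val : ℝ))).det := by
  have hinj : Function.Injective g := by
    intro i j hij
    by_contra hne
    exact hg (Matrix.det_zero_of_column_eq hne (fun k => by simp [hij]))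
  have hmono : StrictMono (g ∘ Tuple.sort g) :=
    (Tuple.monotone_sort g).strictMono_of_injective
      (hinj.comp (Tuple.sort g).injective)
  have h1 : (A.submatrix id (g ∘ Tuple.sort g)).det
      = Equiv.Perm.sign (Tuple.sort g) * (A.submatrix id g).det := by
    rw [← Matrix.det_permute']; rfl
  have h2 : (Matrix.vandermonde (fun k => ((g (Tuple.sort g k)).val : ℝ))).det
      = Equiv.Perm.sign (Tuple.sort g) * (Matrix.vandermonde (fun k => ((g k).val : ℝ))).det := by
    rw [← Matrix.det_permute]; rfl
  have h3 : 0 < (Matrix.vandermonde (fun k => ((g (Tuple.sort g k)).val : ℝ))).det := by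
    rw [Matrix.det_vandermonde]
    refine Finset.prod_pos fun i _ => Finset.prod_pos fun j hj => ?_
    have : g (Tuple.sort g i) < g (Tuple.sort g j) := hmono (Finset.mem_Ioi.1 hj)
    rw [sub_pos]; exact_mod_cast this
  have h4 := hA _ hmono
  have h5 : ((Equiv.Perm.sign (Tuple.sort g) : ℤ) : ℝ) * ((Equiv.Perm.sign (Tuple.sort g) : ℤ) : ℝ) = 1 := by
    rcases Int.units_eq_one_or (Equiv.Perm.sign (Tuple.sort g)) with h | h <;> simp [h]
  have h6 : 0 ≤ (A.submatrix id g).det * (Matrix.vandermonde (fun k => ((g k).val : ℝ))).det := by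
    have := mul_nonneg h4 h3.le
    rw [h1, h2] at this
    calc _ ≤ _ := this
      _ = (((Equiv.Perm.sign (Tuple.sort g) : ℤ) : ℝ) * ((Equiv.Perm.sign (Tuple.sort g) : ℤ) : ℝ)) *
        ((A.submatrix id g).det * (Matrix.vandermonde (fun k => ((g k).val : ℝ))).det) := by ring
      _ = _ := by rw [h5, one_mul]
  refine lt_of_le_of_ne h6 (Ne.symm (mul_ne_zero hg ?_))
  intro h; rw [h, mul_zero] at h2; exact h3.ne' h2

theorem vander_two {m : ℕ} (s : Fin m → ℝ) (x y : ℝ) :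
    (Matrix.vandermonde (Fin.cons x (Fin.cons y s : Fin (m+1) → ℝ) : Fin (m+2) → ℝ)).det =
      (y - x) * ((∏ k, (s k - x)) * (∏ k, (s k - y)) * (Matrix.vandermonde s).det) := by
  rw [Matrix.det_vandermonde, Matrix.det_vandermonde]
  simp only [Fin.prod_univ_succ, Fin.prod_Ioi_zero, Fin.prod_Ioi_succ, Fin.cons_zero, Fin.cons_succ]
  ring

/-- The determinant of columns `x, y, s`. -/
noncomputable def G {n m : ℕ} (A : Matrix (Fin (m+2)) (Fin n) ℝ) (s : Fin m → Fin n)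
    (x y : Fin n) : ℝ :=
  (A.submatrix id (Fin.cons x (Fin.cons y s : Fin (m+1) → Fin n) : Fin (m+2) → Fin n)).det

theorem noncross {n m : ℕ} (A : Matrix (Fin (m+2)) (Fin n) ℝ)
    (hA : ∀ f : Fin (m+2) → Fin n, StrictMono f → 0 ≤ (A.submatrix id f).det)
    (s : Fin m → Fin n) (a c t e : Fin n) (l : ℝ) (hl : l ≠ 0)
    (hat : G A s a t ≠ 0) (hae : G A s a e ≠ 0)
    (hct : G A s c t = l * G A s a t) (hce : G A s c e = l * G A s a e) :
    0 < ((t.val : ℝ) - a.val) * (t.val - c.val) * (e.val - a.val) * (e.val - c.val) := by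
  set h : Fin n → ℝ := fun x => ∏ k, (((s k).val : ℝ) - x.val) with hh
  set V : ℝ := (Matrix.vandermonde (fun k => ((s k).val : ℝ))).det
  have key : ∀ x y, G A s x y ≠ 0 →
      0 < G A s x y * (((y.val : ℝ) - x.val) * (h x * h y * V)) := by
    intro x y hxy
    have := det_sign A hA _ hxy
    have e1 : (fun k => (((Fin.cons x (Fin.cons y s : Fin (m+1) → Fin n) : Fin (m+2) → Fin n) k).val : ℝ))
      = (Fin.cons (x.val : ℝ) (Fin.cons (y.val : ℝ) (fun k => ((s k).val : ℝ)) : Fin (m+1) → ℝ) : Fin (m+2) → ℝ) := by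
      funext k
      refine Fin.cases ?_ (fun k => ?_) k
      · simp
      · refine Fin.cases ?_ (fun k => ?_) k <;> simp
    rw [e1, vander_two] at this
    exact this
  have k1 := key a t hat
  have k2 := key a e hae
  have k3 := key c t (by rw [hct]; exact mul_ne_zero hl hat)
  have k4 := key c e (by rw [hce]; exact mul_ne_zero hl hae)
  rw [hct] at k3
  rw [hce] at k4
  have k := mul_pos (mul_pos k1 k2) (mul_pos k3 k4)
  have e2 : ∀ (p q r u g1 g2 x1 x2 x3 x4 v : ℝ),
      g1 * (p * (x1 * x2 * v)) * (g2 * (q * (x1 * x3 * v))) * (l * g1 * (r * (x4 * x2 * v)) * (l * g2 * (u * (x4 * x3 * v))))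
      = (p * r * q * u) * (l * g1 * g2 * x1 * x2 * x3 * x4 * v * v) ^ 2 := by intros; ring
  rw [e2] at k
  exact pos_of_mul_pos_left k (sq_nonneg _)

/-- A linear functional version of `G` in the second argument. -/
noncomputable def G2 {m : ℕ} (w : Fin m → (Fin (m+2) → ℝ)) (x : Fin (m+2) → ℝ) :
    (Fin (m+2) → ℝ) →ₗ[ℝ] ℝ :=
  (Matrix.detRowAlternating (n := Fin (m+2)) (R := ℝ)).toMultilinearMap.toLinearMap
    (Fin.cons x (Fin.cons 0 w : Fin (m+1) → (Fin (m+2) → ℝ))) 1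

noncomputable def G1 {m : ℕ} (w : Fin m → (Fin (m+2) → ℝ)) (y : Fin (m+2) → ℝ) :
    (Fin (m+2) → ℝ) →ₗ[ℝ] ℝ :=
  (Matrix.detRowAlternating (n := Fin (m+2)) (R := ℝ)).toMultilinearMap.toLinearMap
    (Fin.cons 0 (Fin.cons y w : Fin (m+1) → (Fin (m+2) → ℝ))) 0

theorem G1_apply {m : ℕ} (w : Fin m → (Fin (m+2) → ℝ)) (x y : Fin (m+2) → ℝ) :
    G1 w y x = Matrix.detRowAlternating
      (Fin.cons x (Fin.cons y w : Fin (m+1) → (Fin (m+2) → ℝ)) : Fin (m+2) → (Fin (m+2) → ℝ)) := by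
  simp [G1]

theorem G2_apply {m : ℕ} (w : Fin m → (Fin (m+2) → ℝ)) (x y : Fin (m+2) → ℝ) :
    G2 w x y = Matrix.detRowAlternating
      (Fin.cons x (Fin.cons y w : Fin (m+1) → (Fin (m+2) → ℝ)) : Fin (m+2) → (Fin (m+2) → ℝ)) := by
  have : (1 : Fin (m+2)) = Fin.succ 0 := rfl
  simp only [G2, MultilinearMap.toLinearMap_apply, this, ← Fin.cons_update, Fin.update_cons_zero]
  rfl

theorem G2_eq {n m : ℕ} (A : Matrix (Fin (m+2)) (Fin n) ℝ) (s : Fin m → Fin n) (x y : Fin n) :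
    G2 (fun k i => A i (s k)) (fun i => A i x) (fun i => A i y) = G A s x y := by
  rw [G2_apply, G, ← Matrix.det_transpose]
  unfold Matrix.det
  congr 1
  ext k i
  refine Fin.cases ?_ (fun k => ?_) k
  · rfl
  · refine Fin.cases ?_ (fun k => ?_) k <;> rfl

theorem G1_eq {n m : ℕ} (A : Matrix (Fin (m+2)) (Fin n) ℝ) (s : Fin m → Fin n) (x y : Fin n) :
    G1 (fun k i => A i (s k)) (fun i => A i y) (fun i => A i x) = G A s x y := by
  rw [G1_apply, ← G2_apply, G2_eq]

theorem G_eq_zero_right {n m : ℕ} (A : Matrix (Fin (m+2)) (Fin n) ℝ) (s : Fin m → Fin n) (x y : Fin n)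
    (h : y = x ∨ y ∈ Set.range s) : G A s x y = 0 := by
  unfold G
  rcases h with rfl | ⟨k, rfl⟩
  · exact Matrix.det_zero_of_column_eq (i := 0) (j := Fin.succ 0) (Fin.succ_ne_zero _).symm
      (fun i => by simp)
  · exact Matrix.det_zero_of_column_eq (i := Fin.succ 0) (j := Fin.succ (Fin.succ k))
      (fun h => (Fin.succ_ne_zero _).symm (Fin.succ_injective _ h)) (fun i => by simp)

theorem G_eq_zero_left {n m : ℕ} (A : Matrix (Fin (m+2)) (Fin n) ℝ) (s : Fin m → Fin n) (x y : Fin n)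
    (h : x ∈ Set.range s) : G A s x y = 0 := by
  unfold G
  rcases h with ⟨k, rfl⟩
  exact Matrix.det_zero_of_column_eq (i := 0) (j := Fin.succ (Fin.succ k))
      (Fin.succ_ne_zero _).symm (fun i => by simp)

theorem G_ne_zero {n m : ℕ} (A : Matrix (Fin (m+2)) (Fin n) ℝ) (s : Fin m → Fin n) (x y : Fin n)
    (P : Submodule ℝ (Fin (m+2) → ℝ))
    (hP : P = Submodule.span ℝ ((fun j i => A i j) '' ({x, y} ∪ Set.range s)))
    (h : P = ⊤) : G A s x y ≠ 0 := by
  have : LinearIndependent ℝ (A.submatrix id (Fin.cons x (Fin.cons y s : Fin (m+1) → Fin n) : Fin (m+2) → Fin n)).col := by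
    apply linearIndependent_of_top_le_span_of_card_eq_finrank
    · rw [← h, hP]
      apply Submodule.span_mono
      rintro _ ⟨j, hj, rfl⟩
      rcases hj with (rfl | hj) | ⟨k, rfl⟩
      · exact ⟨0, rfl⟩
      · rw [Set.mem_singleton_iff] at hj; subst hj; exact ⟨Fin.succ 0, rfl⟩
      · exact ⟨k.succ.succ, rfl⟩
    · simp
  rw [Matrix.linearIndependent_cols_iff_isUnit, Matrix.isUnit_iff_isUnit_det] at this
  exact this.ne_zero

/-- Independent columns lying in the span of few columns are few. -/
theorem card_le_of_span {n d : ℕ} (v : Fin n → (Fin d → ℝ)) (R S : Finset (Fin n))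
    (hR : LinearIndepOn ℝ v (R : Set (Fin n)))
    (h : ∀ x ∈ R, v x ∈ Submodule.span ℝ (v '' S)) : R.card ≤ S.card := by
  classical
  have h1 := linearIndependent_le_span_aux' (R := ℝ) (fun x : R => v x) hR
    (S.image v : Finset _) (by
      rintro _ ⟨x, rfl⟩
      simpa using h x x.2)
  simpa using h1.trans (by simpa using Finset.card_image_le)


theorem subval {n : ℕ} (x y : Fin n) :
    (x - y).val = if y.val ≤ x.val then x.val - y.val else n + x.val - y.val := by
  split_ifs with h
  · exact Fin.sub_val_of_le h
  · rw [Fin.coe_sub_iff_lt.2 (Fin.lt_def.2 (by omega))]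

/-- `c` is the element of `C` cyclically preceding (or equal to) `x`. -/
def IsPrev {n : ℕ} (C : Finset (Fin n)) (c x : Fin n) : Prop :=
  c ∈ C ∧ ∀ c' ∈ C, (x - c).val ≤ (x - c').val

theorem exists_prev {n : ℕ} (C : Finset (Fin n)) (hC : C.Nonempty) (x : Fin n) :
    ∃ c, IsPrev C c x :=
  let ⟨c, hc, h⟩ := C.exists_min_image (fun c => (x - c).val) hC
  ⟨c, hc, h⟩

theorem IsPrev.unique {n : ℕ} {C : Finset (Fin n)} {c c' x : Fin n} (h : IsPrev C c x)
    (h' : IsPrev C c' x) : c = c' := by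
  have h1 := h.2 c' h'.1
  have h2 := h'.2 c h.1
  rw [subval, subval] at h1 h2
  apply Fin.ext
  split_ifs at h1 h2 <;> omega

theorem crossing_sign {n : ℕ} {C : Finset (Fin n)} {a c t e : Fin n} (hac : a ≠ c)
    (ht : IsPrev C a t) (he : IsPrev C c e) :
    ((t.val : ℝ) - a.val) * (t.val - c.val) * (e.val - a.val) * (e.val - c.val) ≤ 0 := by
  have h1 := ht.2 c he.1
  have h2 := he.2 a ht.1
  rw [subval, subval] at h1 h2
  have hac' : a.val ≠ c.val := fun h => hac (Fin.ext h)
  have h3 : (((a.val ≤ t.val ∧ t.val ≤ c.val) ∧ (e.val ≤ a.val ∨ c.val ≤ e.val))) ∨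
      ((c.val ≤ e.val ∧ e.val ≤ a.val) ∧ (t.val ≤ c.val ∨ a.val ≤ t.val)) := by
    split_ifs at h1 h2 <;> omega
  have key : ∀ a c t e : ℝ, (a ≤ t ∧ t ≤ c) → (e ≤ a ∨ c ≤ e) →
      (t - a) * (t - c) * (e - a) * (e - c) ≤ 0 := by
    rintro a c t e ⟨h1, h2⟩ h3
    have p1 : (t - a) * (t - c) ≤ 0 := mul_nonpos_of_nonneg_of_nonpos (by linarith) (by linarith)
    have p2 : 0 ≤ (e - a) * (e - c) := by
      rcases h3 with h | h
      · exact mul_nonneg_of_nonpos_of_nonpos (by linarith) (by linarith)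
      · exact mul_nonneg (by linarith) (by linarith)
    have := mul_nonpos_of_nonpos_of_nonneg p1 p2
    linarith
  rcases h3 with ⟨⟨q1, q2⟩, q3⟩ | ⟨⟨q1, q2⟩, q3⟩
  · exact key _ _ _ _ ⟨by exact_mod_cast q1, by exact_mod_cast q2⟩ (by exact_mod_cast q3)
  · have := key c.val a.val e.val t.val ⟨by exact_mod_cast q1, by exact_mod_cast q2⟩ (by exact_mod_cast q3)
    linarith

/-- The complement of a nonempty gap is a cyclic interval. -/
theorem gap_compl {n : ℕ} (C : Finset (Fin n)) (c : Fin n) (hc : c ∈ C)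
    (hne : ∃ x, x ∉ C ∧ IsPrev C c x) :
    ∃ j : Fin n, ∀ x, (x - j).val ≤ (c - j).val ↔ ¬ (x ∉ C ∧ IsPrev C c x) := by
  classical
  obtain ⟨z, hz, hmax⟩ := (Finset.univ.filter fun x => x ∉ C ∧ IsPrev C c x).exists_max_image
    (fun x => (x - c).val) (by obtain ⟨x, hx⟩ := hne; exact ⟨x, by simpa using hx⟩)
  simp only [Finset.mem_filter, Finset.mem_univ, true_and] at hz hmax
  have hzc : z ≠ c := fun h => hz.1 (h ▸ hc)
  have hzc' : z.val ≠ c.val := fun h => hzc (Fin.ext h)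
  have hn : 0 < n := lt_of_le_of_lt (Nat.zero_le _) z.2
  obtain ⟨j, hj⟩ : ∃ j : Fin n, j.val = if z.val + 1 = n then 0 else z.val + 1 := by
    split_ifs with h
    · exact ⟨⟨0, hn⟩, rfl⟩
    · exact ⟨⟨z.val + 1, by have := z.2; omega⟩, rfl⟩
  refine ⟨j, fun x => ?_⟩
  have hK : (x ∉ C ∧ IsPrev C c x) ↔ (0 < (x - c).val ∧ (x - c).val ≤ (z - c).val) := by
    constructor
    · intro hx
      refine ⟨?_, hmax x hx⟩
      have : x.val ≠ c.val := fun h => hx.1 ((Fin.ext h : x = c) ▸ hc)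
      rw [subval]; have := x.2; have := c.2
      split_ifs <;> omega
    · rintro ⟨h1, h2⟩
      have aux : ∀ c' ∈ C, (x - c).val ≤ (x - c').val := by
        intro c' hc'
        have := hz.2.2 c' hc'
        rw [subval] at h1 h2 this ⊢
        rw [subval] at h2 this ⊢
        have := x.2; have := c.2; have := c'.2; have := z.2
        split_ifs at * <;> omega
      refine ⟨fun hx => ?_, hc, aux⟩
      have := aux x hx
      have h3 : (x - x).val = 0 := by rw [subval]; simp
      omega
  rw [hK]
  rw [subval x j, subval c j, subval x c, subval z c, hj]
  have := x.2; have := c.2; have := z.2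
  split_ifs <;> omega


/-- If the columns indexed by `B` are dependent, there is a circuit inside `B`, with an explicit
relation with full support. -/
theorem exists_circuit {n d : ℕ} (v : Fin n → (Fin d → ℝ)) (B : Finset (Fin n))
    (hB : ¬ LinearIndepOn ℝ v (B : Set (Fin n))) :
    ∃ C ⊆ B, C.Nonempty ∧ (∀ c ∈ C, LinearIndepOn ℝ v ((C.erase c : Finset (Fin n)) : Set (Fin n))) ∧
      (¬ LinearIndepOn ℝ v (C : Set (Fin n))) ∧
      ∃ μ : Fin n → ℝ, (∀ c ∈ C, μ c ≠ 0) ∧ ∑ c ∈ C, μ c • v c = 0 := by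
  classical
  obtain ⟨C, hC, hmin⟩ := (B.powerset.filter fun C : Finset (Fin n) => ¬ LinearIndepOn ℝ v (C : Set (Fin n))).exists_min_image
    Finset.card ⟨B, by simp [hB]⟩
  simp only [Finset.mem_filter, Finset.mem_powerset] at hC hmin
  have her : ∀ c ∈ C, LinearIndepOn ℝ v ((C.erase c : Finset (Fin n)) : Set (Fin n)) := by
    intro c hc
    by_contra hcon
    have := hmin (C.erase c) ⟨(Finset.erase_subset _ _).trans hC.1, hcon⟩
    have := Finset.card_erase_lt_of_mem hc
    omega
  have hdep := hC.2
  rw [linearIndepOn_finset_iff] at hdep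
  push Not at hdep
  obtain ⟨μ, h0, i, hi, hne⟩ := hdep
  refine ⟨C, hC.1, ⟨i, hi⟩, her, hC.2, μ, ?_, h0⟩
  intro c hc hzero
  have hic : i ≠ c := by rintro rfl; exact hne hzero
  have := linearIndepOn_finset_iff.1 (her c hc) μ (by
    rw [← h0, ← Finset.add_sum_erase C _ hc, hzero, zero_smul, zero_add]) i (by simp [hi, hic])
  exact hne this

theorem circuit_mem_span {n d : ℕ} (v : Fin n → (Fin d → ℝ)) (C : Finset (Fin n))
    (μ : Fin n → ℝ) (hμ : ∀ c ∈ C, μ c ≠ 0) (h0 : ∑ c ∈ C, μ c • v c = 0) (c : Fin n) (hc : c ∈ C) :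
    v c ∈ Submodule.span ℝ (v '' ((C.erase c : Finset (Fin n)) : Set (Fin n))) := by
  rw [← Finset.add_sum_erase C _ hc] at h0
  have h1 : v c = (-(μ c)⁻¹) • ∑ x ∈ C.erase c, μ x • v x := by
    rw [eq_neg_of_add_eq_zero_right h0, smul_neg, neg_smul, neg_neg, smul_smul,
      inv_mul_cancel₀ (hμ c hc), one_smul]
  rw [h1]
  exact Submodule.smul_mem _ _ (Submodule.sum_mem _ fun x hx =>
    Submodule.smul_mem _ _ (Submodule.subset_span ⟨x, hx, rfl⟩))

/-- The core of the argument: coefficients modulo a circuit vanish across gaps. -/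
theorem coeff_zero {n d : ℕ} (A : Matrix (Fin d) (Fin n) ℝ)
    (hA : ∀ f : Fin d → Fin n, StrictMono f → 0 ≤ (A.submatrix id f).det)
    (C T : Finset (Fin n)) (hCT : Disjoint C T)
    (hcard : C.card + T.card = d + 1)
    (μ : Fin n → ℝ) (hμ : ∀ c ∈ C, μ c ≠ 0) (h0 : ∑ c ∈ C, μ c • (fun i => A i c : Fin d → ℝ) = 0)
    (hspan : Submodule.span ℝ ((fun j i => A i j : Fin n → Fin d → ℝ) '' ((C : Set (Fin n)) ∪ T)) = ⊤)
    (e t a c : Fin n) (ht : t ∈ T) (ha : IsPrev C a t) (hc : IsPrev C c e) (hac : a ≠ c)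
    (ν : Fin n → ℝ) (p : Fin d → ℝ)
    (hp : p ∈ Submodule.span ℝ ((fun j i => A i j : Fin n → Fin d → ℝ) '' (C : Set (Fin n))))
    (he : (fun i => A i e : Fin d → ℝ) = p + ∑ x ∈ T, ν x • (fun i => A i x : Fin d → ℝ)) :
    ν t = 0 := by
  classical
  by_contra hν
  have haC := ha.1
  have hcC := hc.1
  set S : Finset (Fin n) := (C.erase c).erase a ∪ T.erase t with hS
  have hScard : S.card + 2 = d := by
    rw [hS, Finset.card_union_of_disjoint]
    · have h1 : ((C.erase c).erase a).card + 2 = C.card := by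
        have := Finset.card_erase_add_one (Finset.mem_erase.2 ⟨hac, haC⟩)
        have := Finset.card_erase_add_one hcC
        omega
      have := Finset.card_erase_add_one ht
      omega
    · exact hCT.mono ((Finset.erase_subset _ _).trans (Finset.erase_subset _ _)) (Finset.erase_subset _ _)
  obtain ⟨m, rfl⟩ : ∃ m, d = m + 2 := ⟨S.card, hScard.symm⟩
  have hSm : S.card = m := by omega
  set s : Fin m → Fin n := fun k => S.orderEmbOfFin hSm k with hs
  have hrange : Set.range s = S := Finset.range_orderEmbOfFin S hSm
  set v : Fin n → Fin (m+2) → ℝ := fun j i => A i j with hv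
  have hmemS : ∀ x, x ∈ Set.range s ↔ ((x ≠ a ∧ x ≠ c ∧ x ∈ C) ∨ (x ≠ t ∧ x ∈ T)) := by
    intro x; rw [hrange]; simp [hS]; tauto
  -- relation in the first argument
  have hrel : ∀ y, μ a * G A s a y + μ c * G A s c y = 0 := by
    intro y
    have h1 := congrArg (G1 (fun k i => A i (s k)) (v y)) h0
    rw [map_sum, map_zero] at h1
    simp only [map_smul, smul_eq_mul] at h1
    rw [← Finset.add_sum_erase C _ hcC, ← Finset.add_sum_erase _ _ (Finset.mem_erase.2 ⟨hac, haC⟩),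
      Finset.sum_eq_zero] at h1
    · rw [G1_eq, G1_eq] at h1; linarith
    · intro x hx
      simp only [Finset.mem_erase] at hx
      rw [G1_eq, G_eq_zero_left, mul_zero]
      rw [hmemS]; exact Or.inl ⟨hx.1, hx.2.1, hx.2.2⟩
  have hac0 : G A s a c = 0 := by
    have h1 := congrArg (G2 (fun k i => A i (s k)) (v a)) h0
    rw [map_sum, map_zero] at h1
    simp only [map_smul, smul_eq_mul] at h1
    rw [← Finset.add_sum_erase C _ hcC, Finset.sum_eq_zero] at h1
    · rw [G2_eq, add_zero] at h1
      exact (mul_eq_zero.1 h1).resolve_left (hμ c hcC)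
    · intro x hx
      simp only [Finset.mem_erase] at hx
      rw [G2_eq, G_eq_zero_right, mul_zero]
      by_cases hxa : x = a
      · exact Or.inl hxa
      · right; rw [hmemS]; exact Or.inl ⟨hxa, hx.1, hx.2⟩
  have hCzero : ∀ x ∈ C, G A s a x = 0 := by
    intro x hx
    by_cases hxc : x = c
    · rw [hxc, hac0]
    apply G_eq_zero_right
    by_cases hxa : x = a
    · exact Or.inl hxa
    · right; rw [hmemS]; exact Or.inl ⟨hxa, hxc, hx⟩
  have hat : G A s a t ≠ 0 := by
    refine G_ne_zero A s a t _ rfl ?_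
    rw [eq_top_iff, ← hspan, Submodule.span_le]
    have hsub : ∀ x, (x ≠ c ∧ x ∈ C) ∨ x ∈ T → x ∈ (({a, t} : Set (Fin n)) ∪ Set.range s) := by
      intro x hx
      by_cases hxa : x = a
      · simp [hxa]
      by_cases hxt : x = t
      · simp [hxt]
      right
      rw [hmemS]
      tauto
    rintro _ ⟨x, hx, rfl⟩
    by_cases hxc : x = c
    · subst hxc
      refine Submodule.span_mono (Set.image_mono ?_) (circuit_mem_span v C μ hμ h0 x hcC)
      intro y hy
      simp only [Finset.coe_erase, Set.mem_sdiff, Finset.mem_coe, Set.mem_singleton_iff] at hy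
      exact hsub y (Or.inl ⟨hy.2, hy.1⟩)
    · refine Submodule.subset_span ⟨x, hsub x ?_, rfl⟩
      rcases hx with hx | hx
      · exact Or.inl ⟨hxc, hx⟩
      · exact Or.inr hx
  have hp0 : G2 (fun k i => A i (s k)) (v a) p = 0 := by
    have : Submodule.span ℝ (v '' (C : Set (Fin n))) ≤ LinearMap.ker (G2 (fun k i => A i (s k)) (v a)) := by
      rw [Submodule.span_le]
      rintro _ ⟨x, hx, rfl⟩
      rw [SetLike.mem_coe, LinearMap.mem_ker, G2_eq]
      exact hCzero x hx
    exact this hp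
  have hae : G A s a e = ν t * G A s a t := by
    have h1 := congrArg (G2 (fun k i => A i (s k)) (v a)) he
    rw [G2_eq, map_add, hp0, zero_add, map_sum] at h1
    simp only [map_smul, smul_eq_mul] at h1
    rw [← Finset.add_sum_erase T _ ht, Finset.sum_eq_zero, add_zero, G2_eq] at h1
    · exact h1
    · intro x hx
      simp only [Finset.mem_erase] at hx
      rw [G2_eq, G_eq_zero_right, mul_zero]
      right; rw [hmemS]; exact Or.inr hx
  have hl : ∀ y, G A s c y = (-(μ a / μ c)) * G A s a y := by
    intro y
    have := hrel y
    have h2 := hμ c hcC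
    field_simp
    linarith
  have := noncross A hA s a c t e (-(μ a / μ c)) (neg_ne_zero.2 (div_ne_zero (hμ a haC) (hμ c hcC)))
    hat (by rw [hae]; exact mul_ne_zero hν hat) (hl t) (hl e)
  exact absurd this (not_lt.2 (crossing_sign hac ha hc))

theorem oh {n d : ℕ} (A : Matrix (Fin d) (Fin n) ℝ)
    (hA : ∀ f : Fin d → Fin n, StrictMono f → 0 ≤ (A.submatrix id f).det)
    (hspan : Submodule.span ℝ (Set.range (fun j i => A i j : Fin n → Fin d → ℝ)) = ⊤)
    (B : Finset (Fin n)) (hB : B.card = d)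
    (hJ : ∀ j l : Fin n, ∃ R : Finset (Fin n), (∀ x ∈ R, (x - j).val ≤ (l - j).val) ∧
      LinearIndepOn ℝ (fun j i => A i j : Fin n → Fin d → ℝ) (R : Set (Fin n)) ∧
      (B.filter fun x => (x - j).val ≤ (l - j).val).card ≤ R.card) :
    LinearIndepOn ℝ (fun j i => A i j : Fin n → Fin d → ℝ) (B : Set (Fin n)) := by
  classical
  by_contra hdep
  set v : Fin n → Fin d → ℝ := fun j i => A i j with hv
  obtain ⟨C, hCB, hCne, her, hCdep, μ, hμ, h0⟩ := exists_circuit v B hdep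
  obtain ⟨c0, hc0⟩ := hCne
  set β : Set (Fin n) := (her c0 hc0).extend (Set.subset_univ _) with hβ
  have hβind : LinearIndepOn ℝ v β := (her c0 hc0).linearIndepOn_extend _
  have hβsub : ((C.erase c0 : Finset (Fin n)) : Set (Fin n)) ⊆ β := (her c0 hc0).subset_extend _
  have hβspan : Submodule.span ℝ (v '' β) = ⊤ := by
    rw [(her c0 hc0).span_image_extend_eq_span_image, Set.image_univ, hspan]
  set T : Finset (Fin n) := Finset.univ.filter fun x => x ∈ β ∧ x ∉ C with hT
  have hmemT : ∀ x, x ∈ T ↔ x ∈ β ∧ x ∉ C := fun x => by simp [hT]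
  have hc0β : c0 ∉ β := by
    intro h
    apply hCdep
    refine hβind.mono ?_
    intro x hx
    by_cases hxc : x = c0
    · rw [hxc]; exact h
    · exact hβsub (by simp [hxc, Finset.mem_coe.1 hx])
  have hCT : Disjoint C T := by
    rw [Finset.disjoint_left]; intro x hx hx'; exact ((hmemT x).1 hx').2 hx
  have hβeq : β = ((C.erase c0 ∪ T : Finset (Fin n)) : Set (Fin n)) := by
    ext x
    simp only [Finset.coe_union, Set.mem_union, Finset.mem_coe, Finset.mem_erase, hmemT]
    constructor
    · intro hx
      by_cases hxC : x ∈ C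
      · exact Or.inl ⟨fun h => hc0β (h ▸ hx), hxC⟩
      · exact Or.inr ⟨hx, hxC⟩
    · rintro (h | h)
      · exact hβsub (by simp [h.1, h.2])
      · exact h.1
  have hβcard : (C.erase c0 ∪ T).card = d := by
    apply le_antisymm
    · have := (hβeq ▸ hβind : LinearIndepOn ℝ v ((C.erase c0 ∪ T : Finset (Fin n)) : Set (Fin n)))
      have h1 := LinearIndependent.fintype_card_le_finrank this
      rw [Module.finrank_fin_fun] at h1
      exact (Fintype.card_coe _).symm.le.trans h1
    · have h1 := finrank_span_finset_le_card (R := ℝ) ((C.erase c0 ∪ T).image v)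
      rw [Finset.coe_image, ← hβeq, Set.finrank, hβspan, finrank_top] at h1
      simpa using h1.trans Finset.card_image_le
  have hcard : C.card + T.card = d + 1 := by
    rw [Finset.card_union_of_disjoint (hCT.mono_left (Finset.erase_subset _ _))] at hβcard
    have := Finset.card_erase_add_one hc0
    omega
  have hCspan : Submodule.span ℝ (v '' (C : Set (Fin n))) ≤
      Submodule.span ℝ (v '' ((C.erase c0 : Finset (Fin n)) : Set (Fin n))) := by
    rw [Submodule.span_le]
    rintro _ ⟨x, hx, rfl⟩
    by_cases hxc : x = c0
    · subst hxc; exact circuit_mem_span v C μ hμ h0 _ hc0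
    · exact Submodule.subset_span ⟨x, by simp [hxc, Finset.mem_coe.1 hx], rfl⟩
  choose pr hpr using exists_prev C ⟨c0, hc0⟩
  -- pigeonhole
  obtain ⟨c, hcC, hclt⟩ : ∃ c ∈ C, ((B \ C).filter fun x => pr x = c).card
      < (T.filter fun x => pr x = c).card := by
    apply Finset.exists_lt_of_sum_lt
    rw [← Finset.card_eq_sum_card_fiberwise (fun x _ => (hpr x).1),
      ← Finset.card_eq_sum_card_fiberwise (fun x _ => (hpr x).1),
      Finset.card_sdiff_of_subset hCB]
    have := Finset.card_le_card hCB
    omega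
  obtain ⟨z, hz⟩ : (T.filter fun x => pr x = c).Nonempty := by
    rw [← Finset.card_pos]; omega
  simp only [Finset.mem_filter] at hz
  obtain ⟨j, hj⟩ := gap_compl C c hcC ⟨z, ((hmemT z).1 hz.1).2, hz.2 ▸ hpr z⟩
  have hgap : ∀ x, (x - j).val ≤ (c - j).val ↔ (x ∈ C ∨ pr x ≠ c) := by
    intro x
    rw [hj]
    constructor
    · intro h
      by_contra hcon
      push Not at hcon
      exact h ⟨hcon.1, hcon.2 ▸ hpr x⟩
    · rintro (h | h) ⟨h1, h2⟩
      · exact h1 h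
      · exact h ((hpr x).unique h2)
  obtain ⟨R, hR1, hR2, hR3⟩ := hJ j c
  have hRle : R.card ≤ (C.erase c0 ∪ T.filter fun x => pr x ≠ c).card := by
    refine card_le_of_span v R _ hR2 ?_
    intro e heR
    have hmono : Submodule.span ℝ (v '' (C : Set (Fin n))) ≤ Submodule.span ℝ (v '' ((C.erase c0 ∪ T.filter fun x => pr x ≠ c : Finset (Fin n)) : Set (Fin n))) :=
      hCspan.trans (Submodule.span_mono (Set.image_mono (by
        rw [Finset.coe_union]; exact Set.subset_union_left)))
    by_cases heC : e ∈ C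
    · exact hmono (Submodule.subset_span ⟨e, heC, rfl⟩)
    have hec : pr e ≠ c := ((hgap e).1 (hR1 e heR)).resolve_left heC
    have hmem : v e ∈ Submodule.span ℝ (v '' (C : Set (Fin n))) ⊔ Submodule.span ℝ (v '' (T : Set (Fin n))) := by
      rw [← Submodule.span_union, ← Set.image_union]
      have : v e ∈ Submodule.span ℝ (v '' β) := by rw [hβspan]; trivial
      refine Submodule.span_mono (Set.image_mono ?_) this
      rw [hβeq, Finset.coe_union]
      exact Set.union_subset_union_left _ (by simp)
    obtain ⟨p, hp, q, hq, hpq⟩ := Submodule.mem_sup.1 hmem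
    rw [Submodule.mem_span_image_finset_iff_exists_fun] at hq
    obtain ⟨ν', hν'⟩ := hq
    obtain ⟨ν, hν⟩ : ∃ ν : Fin n → ℝ, ∑ x ∈ T, ν x • v x = q := by
      refine ⟨fun x => if h : x ∈ T then ν' ⟨x, h⟩ else 0, ?_⟩
      rw [← hν', ← Finset.sum_coe_sort]
      refine Finset.sum_congr rfl fun x _ => ?_
      simp
    rw [← hpq, ← hν]
    refine Submodule.add_mem _ (hmono hp) (Submodule.sum_mem _ fun t ht => ?_)
    by_cases htc : pr t = c
    · have : ν t = 0 := by
        refine coeff_zero A hA C T hCT hcard μ hμ h0 ?_ e t (pr t) (pr e) ht (hpr t) (hpr e)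
          (by rw [htc]; exact hec.symm) ν p hp (by rw [hν]; exact hpq.symm)
        rw [eq_top_iff, ← hβspan, hβeq, Finset.coe_union]
        exact Submodule.span_mono (Set.image_mono (Set.union_subset_union_left _ (by simp)))
      rw [this, zero_smul]; exact Submodule.zero_mem _
    · exact Submodule.smul_mem _ _ (Submodule.subset_span ⟨t, by simp [ht, htc], rfl⟩)
  have h1 : (C.erase c0 ∪ T.filter fun x => pr x ≠ c).card + (T.filter fun x => pr x = c).card ≤ d := by
    have h2 := Finset.card_union_le (C.erase c0) (T.filter fun x => pr x ≠ c)
    have h3 := Finset.card_filter_add_card_filter_not (s := T) (fun x => pr x = c)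
    have h4 := Finset.card_erase_add_one hc0
    simp only [ne_eq] at *
    omega
  have h5 : (B.filter fun x => (x - j).val ≤ (c - j).val).card +
      ((B \ C).filter fun x => pr x = c).card = d := by
    rw [← hB, ← Finset.card_filter_add_card_filter_not (s := B) (fun x => (x - j).val ≤ (c - j).val)]
    congr 2
    ext x
    simp only [Finset.mem_filter, Finset.mem_sdiff, hgap]
    tauto
  omega


theorem sub_inj' {n : ℕ} {x y j : Fin n} (h : x - j = y - j) : x = y := by
  have h1 := congrArg Fin.val h
  rw [subval, subval] at h1
  apply Fin.ext
  have := x.2; have := y.2; have := j.2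
  split_ifs at h1 <;> omega

theorem emb_of_count {n d : ℕ} (S : Finset (Fin n)) (hS : S.card = d) (U : Finset (Fin n)) (hU : U ⊆ S)
    (q : Fin n → Prop) (hq : ∀ x y, x ≤ y → q y → q x) (hUq : ∀ u ∈ U, q u) (l : Fin d)
    (hl : l.val < U.card) : q (S.orderEmbOfFin hS l) := by
  classical
  by_contra hcon
  have hsub : U ⊆ (Finset.Iio l).image (S.orderEmbOfFin hS) := by
    intro u hu
    have : u ∈ Set.range (S.orderEmbOfFin hS) := by
      rw [Finset.range_orderEmbOfFin]; exact hU hu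
    obtain ⟨i, rfl⟩ := this
    refine Finset.mem_image.2 ⟨i, Finset.mem_Iio.2 ?_, rfl⟩
    by_contra hi
    exact hcon (hq _ _ ((S.orderEmbOfFin hS).monotone (not_lt.1 hi)) (hUq _ hu))
  have := (Finset.card_le_card hsub).trans Finset.card_image_le
  rw [Fin.card_Iio] at this
  omega

/-- Bases satisfy the necklace inequalities. -/
theorem gale (n d : ℕ) (A : Matrix (Fin d) (Fin n) ℝ) (ℬ : Finset (Fin n) → Prop)
    (hspan : Submodule.span ℝ (Set.range (fun j i => A i j : Fin n → Fin d → ℝ)) = ⊤)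
    (hrep : A.RepresentsBases ℬ)
    (I : Fin n → Finset (Fin n))
    (hIbase : ∀ j, ℬ (I j))
    (hImin : ∀ j B, ℬ B →
      LexLE d ((I j).image (fun x => x - j)) (B.image (fun x => x - j)))
    (a : Fin n → Fin d → Fin n)
    (haMono : ∀ j, StrictMono fun k : Fin d => a j k - j)
    (haEnum : ∀ j, I j = Finset.image (a j) Finset.univ)
    (B : Finset (Fin n)) (hB : ℬ B) (j : Fin n) (k : Fin d) :
    (B.filter fun x => x ∈ cycIntTo j (a j k)).card ≤ k.val := by
  classical
  by_contra hcon
  push Not at hcon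
  set v : Fin n → Fin d → ℝ := fun j i => A i j with hv
  have hainj : Function.Injective (a j) := fun x y h => (haMono j).injective (by simp [h])
  set P : Finset (Fin n) := (Finset.Iio k).image (a j) with hP
  have hPcard : P.card = k.val := by
    rw [hP, Finset.card_image_of_injective _ hainj, Fin.card_Iio]
  have hPind : LinearIndepOn ℝ v (P : Set (Fin n)) := by
    refine LinearIndepOn.mono ((hrep _).1 (hIbase j)).2 ?_
    intro x hx
    have hx' : x ∈ P := hx
    rw [haEnum j]
    obtain ⟨i, _, rfl⟩ := Finset.mem_image.1 hx'
    simp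
  have hQind : LinearIndepOn ℝ v ((B.filter fun x => x ∈ cycIntTo j (a j k) : Finset (Fin n)) : Set (Fin n)) :=
    LinearIndepOn.mono ((hrep _).1 hB).2 (Finset.coe_subset.2 (Finset.filter_subset _ _))
  obtain ⟨x, hxQ, hxs⟩ : ∃ x ∈ (B.filter fun x => x ∈ cycIntTo j (a j k)), v x ∉ Submodule.span ℝ (v '' P) := by
    by_contra h
    push Not at h
    have := card_le_of_span v _ P hQind h
    omega
  have hxP : x ∉ P := fun h => hxs (Submodule.subset_span ⟨x, h, rfl⟩)
  have hxlt : x - j < a j k - j := by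
    have := (Finset.mem_filter.1 hxQ).2
    simpa [cycIntTo] using this
  have hins : LinearIndepOn ℝ v (insert x (P : Set (Fin n))) :=
    (linearIndepOn_insert (by simpa using hxP)).2 ⟨hPind, hxs⟩
  set β : Set (Fin n) := hins.extend (Set.subset_univ _) with hβ
  have hβind : LinearIndepOn ℝ v β := hins.linearIndepOn_extend _
  have hβsub : insert x (P : Set (Fin n)) ⊆ β := hins.subset_extend _
  have hβspan : Submodule.span ℝ (v '' β) = ⊤ := by
    rw [hins.span_image_extend_eq_span_image, Set.image_univ, hspan]
  set B' : Finset (Fin n) := Finset.univ.filter fun x => x ∈ β with hB'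
  have hβeq : β = (B' : Set (Fin n)) := by ext x; simp [hB']
  have hind' : LinearIndepOn ℝ v (B' : Set (Fin n)) := hβeq ▸ hβind
  have hcard : B'.card = d := by
    apply le_antisymm
    · have h1 := LinearIndependent.fintype_card_le_finrank hind'
      rw [Module.finrank_fin_fun] at h1
      exact (Fintype.card_coe _).symm.le.trans h1
    · have h1 := finrank_span_finset_le_card (R := ℝ) (B'.image v)
      rw [Finset.coe_image, ← hβeq, Set.finrank, hβspan, finrank_top] at h1
      simpa using h1.trans Finset.card_image_le
  have hBB : ℬ B' := (hrep _).2 ⟨hcard, hind'⟩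
  obtain ⟨hS, hT, hlex⟩ := hImin j B' hBB
  have hIe : ∀ l, ((((I j).image (fun x => x - j)).orderIsoOfFin hS l : _) : Fin n) = a j l - j := by
    have := Finset.orderEmbOfFin_unique hS (f := fun l => a j l - j) (fun l => by
      refine Finset.mem_image.2 ⟨a j l, ?_, rfl⟩
      rw [haEnum j]; simp) (haMono j)
    intro l
    rw [Finset.coe_orderIsoOfFin_apply]
    exact (congrFun this l).symm
  have hsubB : ∀ y, y = x ∨ y ∈ P → y - j ∈ B'.image (fun x => x - j) := by
    intro y hy
    refine Finset.mem_image_of_mem _ ?_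
    rw [← Finset.mem_coe, ← hβeq]
    exact hβsub (by simpa using hy)
  have hlt : (((B'.image (fun x => x - j)).orderIsoOfFin hT k : _) : Fin n) < a j k - j := by
    rw [Finset.coe_orderIsoOfFin_apply]
    refine emb_of_count _ hT ((insert x P).image (fun x => x - j)) ?_ (fun z => z < a j k - j)
      (fun _ _ => lt_of_le_of_lt) ?_ k ?_
    · intro u hu
      obtain ⟨y, hy, rfl⟩ := Finset.mem_image.1 hu
      exact hsubB y (Finset.mem_insert.1 hy)
    · intro u hu
      obtain ⟨y, hy, rfl⟩ := Finset.mem_image.1 hu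
      rcases Finset.mem_insert.1 hy with rfl | hy
      · exact hxlt
      · obtain ⟨i, hi, rfl⟩ := Finset.mem_image.1 hy
        exact haMono j (Finset.mem_Iio.1 hi)
    · rw [Finset.card_image_of_injective _ (fun _ _ h => sub_inj' h), Finset.card_insert_of_notMem hxP]
      omega
  have hle : ∀ l, l < k → (((B'.image (fun x => x - j)).orderIsoOfFin hT l : _) : Fin n) ≤ a j l - j := by
    intro l hl
    rw [Finset.coe_orderIsoOfFin_apply]
    refine emb_of_count _ hT (((Finset.Iic l).image (a j)).image (fun x => x - j)) ?_ (fun z => z ≤ a j l - j)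
      (fun _ _ => le_trans) ?_ l ?_
    · intro u hu
      obtain ⟨y, hy, rfl⟩ := Finset.mem_image.1 hu
      obtain ⟨i, hi, rfl⟩ := Finset.mem_image.1 hy
      exact hsubB _ (Or.inr (Finset.mem_image_of_mem _
        (Finset.mem_Iio.2 (lt_of_le_of_lt (Finset.mem_Iic.1 hi) hl))))
    · intro u hu
      obtain ⟨y, hy, rfl⟩ := Finset.mem_image.1 hu
      obtain ⟨i, hi, rfl⟩ := Finset.mem_image.1 hy
      exact (haMono j).monotone (Finset.mem_Iic.1 hi)
    · rw [Finset.card_image_of_injective _ (fun _ _ h => sub_inj' h),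
        Finset.card_image_of_injective _ hainj, Fin.card_Iic]
      omega
  rcases hlex with heq | ⟨m, hm1, hm2⟩
  · have hgen : ∀ (S' : Finset (Fin n)) (h' : S'.card = d), (I j).image (fun x => x - j) = S' →
        ((((I j).image (fun x => x - j)).orderIsoOfFin hS k : _) : Fin n) = S'.orderIsoOfFin h' k := by
      rintro _ _ rfl; rfl
    have := hIe k
    rw [hgen _ hT heq] at this
    exact absurd this hlt.ne
  · rw [hIe] at hm2
    rcases lt_trichotomy m k with h | h | h
    · exact absurd hm2 (not_lt.2 (hle m h))
    · subst h; exact absurd hm2 (not_lt.2 hlt.le)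
    · have := hm1 k h
      rw [hIe] at this
      exact absurd this.symm hlt.ne

theorem span_top_of_rank {n d : ℕ} (A : Matrix (Fin d) (Fin n) ℝ) (h : A.rank = d) :
    Submodule.span ℝ (Set.range (fun j i => A i j : Fin n → Fin d → ℝ)) = ⊤ := by
  rw [Matrix.rank_eq_finrank_span_cols] at h
  apply Submodule.eq_top_of_finrank_eq
  rw [Module.finrank_fin_fun]
  exact h

/-- Sets satisfying the necklace inequalities are bases. -/
theorem oh_necklace (n d : ℕ) (A : Matrix (Fin d) (Fin n) ℝ) (ℬ : Finset (Fin n) → Prop)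
    (hA : A.TotallyNonneg)
    (hrep : A.RepresentsBases ℬ)
    (I : Fin n → Finset (Fin n))
    (hIbase : ∀ j, ℬ (I j))
    (a : Fin n → Fin d → Fin n)
    (haMono : ∀ j, StrictMono fun k : Fin d => a j k - j)
    (haEnum : ∀ j, I j = Finset.image (a j) Finset.univ)
    (B : Finset (Fin n)) (hB : B.card = d)
    (h : ∀ j k, (B.filter fun x => x ∈ cycIntTo j (a j k)).card ≤ k.val) : ℬ B := by
  classical
  refine (hrep B).2 ⟨hB, ?_⟩
  refine oh A hA.2 (span_top_of_rank A hA.1) B hB ?_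
  intro j l
  refine ⟨(I j).filter fun x => (x - j).val ≤ (l - j).val, fun x hx => (Finset.mem_filter.1 hx).2,
    LinearIndepOn.mono ((hrep _).1 (hIbase j)).2 (Finset.coe_subset.2 (Finset.filter_subset _ _)), ?_⟩
  have hainj : Function.Injective (a j) := fun x y h => (haMono j).injective (by simp [h])
  by_cases hall : ∀ k, (a j k - j).val ≤ (l - j).val
  · have : (I j).filter (fun x => (x - j).val ≤ (l - j).val) = I j := by
      rw [Finset.filter_eq_self]
      intro x hx
      rw [haEnum j] at hx
      obtain ⟨i, _, rfl⟩ := Finset.mem_image.1 hx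
      exact hall i
    rw [this, ((hrep _).1 (hIbase j)).1, ← hB]
    exact Finset.card_le_card (Finset.filter_subset _ _)
  · push Not at hall
    obtain ⟨k, hk, hkmin⟩ := (Finset.univ.filter fun k => (l - j).val < (a j k - j).val).exists_min_image id
      (by obtain ⟨k, hk⟩ := hall; exact ⟨k, by simpa using hk⟩)
    have hk' : (l - j).val < (a j k - j).val := (Finset.mem_filter.1 hk).2
    calc _ ≤ (B.filter fun x => x ∈ cycIntTo j (a j k)).card := by
            apply Finset.card_le_card
            intro x hx
            rw [Finset.mem_filter] at hx ⊢
            refine ⟨hx.1, ?_⟩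
            simp only [cycIntTo, Finset.mem_filter, Finset.mem_univ, true_and]
            omega
      _ ≤ k.val := h j k
      _ = ((Finset.Iio k).image (a j)).card := by
            rw [Finset.card_image_of_injective _ hainj, Fin.card_Iio]
      _ ≤ _ := by
            apply Finset.card_le_card
            intro x hx
            obtain ⟨i, hi, rfl⟩ := Finset.mem_image.1 hx
            rw [Finset.mem_filter]
            refine ⟨by rw [haEnum j]; simp, ?_⟩
            by_contra hcon
            push Not at hcon
            have := hkmin i (by simpa using hcon)
            exact absurd (Finset.mem_Iio.1 hi) (not_lt.2 this)


theorem sum_range_filter {n : ℕ} (Y : ℕ → ℝ) (p q : ℕ) (hpq : p ≤ q) (hq : q ≤ n) :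
    ∑ l ∈ Finset.univ.filter (fun l : Fin n => p ≤ l.val ∧ l.val < q), (Y (l.val + 1) - Y l.val)
      = Y q - Y p := by
  rw [← Finset.sum_Ico_sub Y hpq]
  refine Finset.sum_bij (fun l _ => l.val) ?_ ?_ ?_ ?_
  · intro l hl; simpa using hl
  · intro l _ l' _ h; exact Fin.ext h
  · intro b hb
    rw [Finset.mem_Ico] at hb
    exact ⟨⟨b, by omega⟩, by simpa using hb, rfl⟩
  · intro l _; rfl

/-- Cyclic interval sums of a difference sequence. -/
theorem cyc_sum {n : ℕ} (Y : ℕ → ℝ) (j b : Fin n) :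
    ∑ l ∈ cycIntTo j b, (Y (l.val + 1) - Y l.val) =
      if j.val ≤ b.val then Y b.val - Y j.val else (Y n - Y 0) - (Y j.val - Y b.val) := by
  split_ifs with h
  · rw [← sum_range_filter (n := n) Y j.val b.val h b.2.le]
    refine Finset.sum_congr ?_ fun _ _ => rfl
    ext l
    simp only [cycIntTo, Finset.mem_filter, Finset.mem_univ, true_and]
    rw [subval, subval]
    have := l.2; have := j.2; have := b.2
    split_ifs <;> omega
  · rw [← sum_range_filter (n := n) Y b.val j.val (by omega) j.2.le,
      ← sum_range_filter (n := n) Y 0 n (by omega) le_rfl, eq_sub_iff_add_eq, ← Finset.sum_union]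
    · refine Finset.sum_congr ?_ fun _ _ => rfl
      ext l
      simp only [cycIntTo, Finset.mem_filter, Finset.mem_univ, true_and, Finset.mem_union]
      rw [subval, subval]
      have := l.2; have := j.2; have := b.2
      split_ifs <;> omega
    · rw [Finset.disjoint_left]
      intro l
      simp only [cycIntTo, Finset.mem_filter, Finset.mem_univ, true_and]
      rw [subval, subval]
      have := l.2; have := j.2; have := b.2
      split_ifs <;> omega

theorem floor_int (y : ℝ) : IntervalIntegrable (fun t : ℝ => (⌊y + t⌋ : ℝ)) MeasureTheory.volume 0 1 := by
  apply Monotone.intervalIntegrable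
  intro s t h
  have h1 : ⌊y + s⌋ ≤ ⌊y + t⌋ := Int.floor_mono (by linarith)
  exact Int.cast_le.2 h1

theorem integral_floor (y : ℝ) : ∫ t in (0:ℝ)..1, (⌊y + t⌋ : ℝ) = y := by
  have hper : Function.Periodic (fun t : ℝ => Int.fract t) 1 := fun t => Int.fract_add_one t
  have h1 : ∫ t in (0:ℝ)..1, Int.fract (y + t) = 1 / 2 := by
    rw [intervalIntegral.integral_comp_add_left (fun t => Int.fract t) y, add_zero,
      hper.intervalIntegral_add_eq y 0, zero_add]
    have : ∫ t in (0:ℝ)..1, Int.fract t = ∫ t in (0:ℝ)..1, t := by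
      apply intervalIntegral.integral_congr_ae
      have h1 : ∀ᵐ x : ℝ ∂MeasureTheory.volume, x ≠ 1 := by
        simp [MeasureTheory.ae_iff]
      filter_upwards [h1] with x hx hx'
      rw [Set.uIoc_of_le zero_le_one] at hx'
      exact Int.fract_eq_self.2 ⟨hx'.1.le, lt_of_le_of_ne hx'.2 hx⟩
    rw [this]; simp
  have h2 : ∀ t : ℝ, (Int.fract (y + t)) = (y + t) - (⌊y + t⌋ : ℝ) := fun t => rfl
  simp only [h2] at h1
  rw [intervalIntegral.integral_sub (Continuous.intervalIntegrable (by fun_prop) _ _) (floor_int y),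
    intervalIntegral.integral_add (by simp) (by simp)] at h1
  simp at h1
  linarith

theorem hull_aux {n : ℕ} (s : Set (Fin n → ℝ)) (hs : s.Finite) (ν : MeasureTheory.Measure ℝ)
    [MeasureTheory.IsProbabilityMeasure ν] (f : ℝ → Fin n → ℝ) (hf : ∀ t, f t ∈ s)
    (hint : ∀ l, MeasureTheory.Integrable (fun t => f t l) ν) :
    (fun l => ∫ t, f t l ∂ν) ∈ convexHull ℝ s := by
  have hcl : IsClosed (convexHull ℝ s) := hs.isClosed_convexHull (𝕜 := ℝ)
  have key : ∫ t, f t ∂ν ∈ convexHull ℝ s :=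
    (convex_convexHull ℝ s).integral_mem hcl
      (Filter.Eventually.of_forall fun t => subset_convexHull ℝ s (hf t))
      (MeasureTheory.Integrable.of_eval hint)
  have h2 : (fun l => ∫ t, f t l ∂ν) = ∫ t, f t ∂ν := by
    funext l
    exact (MeasureTheory.eval_integral hint l).symm
  rw [h2]
  exact key

/-- Rounding: a point all of whose roundings lie in `s` is in the convex hull of `s`. -/
theorem mem_hull {n : ℕ} (s : Set (Fin n → ℝ)) (hs : s.Finite) (y : ℕ → ℝ)
    (h : ∀ t : ℝ, (fun l : Fin n => ((⌊y (l.val + 1) + t⌋ : ℝ) - (⌊y l.val + t⌋ : ℝ))) ∈ s) :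
    (fun l : Fin n => y (l.val + 1) - y l.val) ∈ convexHull ℝ s := by
  have : MeasureTheory.IsProbabilityMeasure (MeasureTheory.volume.restrict (Set.Ioc (0:ℝ) 1)) :=
    ⟨by simp⟩
  have hint : ∀ l : Fin n, MeasureTheory.Integrable
      (fun t : ℝ => ((⌊y (l.val + 1) + t⌋ : ℝ) - (⌊y l.val + t⌋ : ℝ)))
      (MeasureTheory.volume.restrict (Set.Ioc (0:ℝ) 1)) := by
    intro l
    have := (floor_int (y (l.val+1))).sub (floor_int (y l.val))
    rw [intervalIntegrable_iff_integrableOn_Ioc_of_le zero_le_one] at this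
    exact this
  have key := hull_aux s hs _ _ h hint
  have h2 : (fun l : Fin n => ∫ t in Set.Ioc (0:ℝ) 1,
      ((⌊y (l.val + 1) + t⌋ : ℝ) - (⌊y l.val + t⌋ : ℝ))) = fun l : Fin n => y (l.val + 1) - y l.val := by
    funext l
    rw [← intervalIntegral.integral_of_le zero_le_one,
      intervalIntegral.integral_sub (floor_int _) (floor_int _), integral_floor, integral_floor]
  rw [← h2]
  exact key

theorem floor_sub_le (p q : ℝ) (c : ℤ) (h : p - q ≤ c) (t : ℝ) :
    (⌊p + t⌋ : ℝ) - (⌊q + t⌋ : ℝ) ≤ c := by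
  have h1 : ⌊p + t⌋ ≤ ⌊q + t + c⌋ := Int.floor_mono (by linarith)
  rw [Int.floor_add_intCast] at h1
  have h2 : ((⌊p + t⌋ : ℤ) : ℝ) ≤ ((⌊q + t⌋ + c : ℤ) : ℝ) := by exact_mod_cast h1
  push_cast at h2
  linarith

theorem sum_indicator {n : ℕ} (B S : Finset (Fin n)) :
    ∑ l ∈ S, (if l ∈ B then (1:ℝ) else 0) = ((B.filter fun x => x ∈ S).card : ℝ) := by
  rw [Finset.sum_ite_mem, Finset.sum_const, nsmul_eq_mul, mul_one]
  congr 2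
  ext x; simp [and_comm]

end PosPoly

/-- Let `M` be a rank-`d` positroid on `[n]` (modeled on
`Fin n`) with Grassmann necklace `(I_1, ..., I_n)`, where `I j` is the
lexicographically minimal basis of `M` with respect to the `j`-order (expressed
via the shift `x ↦ x - j`), and for each `j` let
`a j 0 <_j a j 1 <_j ... <_j a j (d-1)` be the increasing (in the `j`-order)
enumeration of the elements of `I j`.  Then the matroid polytope `Γ_M` is the
set of `x ∈ ℝ^n` with `x_1 + ... + x_n = d`, `x_j ≥ 0` for all `j`, and, for
all `j ∈ [n]` and `k ∈ [d]` (here `k : Fin d` stands for `k+1 ∈ [d]`), the sum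
of `x_ℓ` over the cyclic interval `[j, a^j_k - 1]` (empty when `a^j_k = j`) is
at most `k - 1`. -/
theorem positroid_polytope_inequalities (n d : ℕ) (ℬ : Finset (Fin n) → Prop)
    (hpos : IsPositroidOfRank d ℬ)
    (I : Fin n → Finset (Fin n))
    (hIbase : ∀ j, ℬ (I j))
    (hImin : ∀ j B, ℬ B →
      LexLE d ((I j).image (fun x => x - j)) (B.image (fun x => x - j)))
    (a : Fin n → Fin d → Fin n)
    (haMono : ∀ j, StrictMono fun k : Fin d => a j k - j)
    (haEnum : ∀ j, I j = Finset.image (a j) Finset.univ) :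
    matroidPolytope ℬ =
      {x : Fin n → ℝ | (∑ i, x i) = (d : ℝ) ∧ (∀ j, 0 ≤ x j) ∧
        ∀ (j : Fin n) (k : Fin d), ∑ ℓ ∈ cycIntTo j (a j k), x ℓ ≤ (k.val : ℝ)} := by
    classical
  obtain ⟨A, hA, hrep⟩ := hpos
  apply Set.Subset.antisymm
  · refine convexHull_min ?_ ?_
    · rintro x ⟨B, hB, rfl⟩
      refine ⟨?_, fun j => by dsimp only; split_ifs <;> norm_num, fun j k => ?_⟩
      · rw [PosPoly.sum_indicator, ← ((hrep B).1 hB).1]; simp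
      · rw [PosPoly.sum_indicator]
        exact_mod_cast PosPoly.gale n d A ℬ (PosPoly.span_top_of_rank A hA.1) hrep I hIbase hImin a
          haMono haEnum B hB j k
    · rintro x ⟨hx1, hx2, hx3⟩ y ⟨hy1, hy2, hy3⟩ p q hp hq hpq
      refine ⟨?_, fun j => ?_, fun j k => ?_⟩
      · simp only [Pi.add_apply, Pi.smul_apply, smul_eq_mul, Finset.sum_add_distrib, ← Finset.mul_sum,
          hx1, hy1]
        rw [← add_mul, hpq, one_mul]
      · simp only [Pi.add_apply, Pi.smul_apply, smul_eq_mul]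
        exact add_nonneg (mul_nonneg hp (hx2 j)) (mul_nonneg hq (hy2 j))
      · simp only [Pi.add_apply, Pi.smul_apply, smul_eq_mul, Finset.sum_add_distrib, ← Finset.mul_sum]
        calc _ ≤ p * (k.val : ℝ) + q * (k.val : ℝ) :=
              add_le_add (mul_le_mul_of_nonneg_left (hx3 j k) hp) (mul_le_mul_of_nonneg_left (hy3 j k) hq)
          _ = _ := by rw [← add_mul, hpq, one_mul]
  · rintro x ⟨hx1, hx2, hx3⟩
    -- every coordinate is at most one
    have hle1 : ∀ l, x l ≤ 1 := by
      intro l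
      by_cases hd : d ≤ 1
      · calc x l ≤ ∑ i, x i := Finset.single_le_sum (fun i _ => hx2 i) (Finset.mem_univ l)
          _ = d := hx1
          _ ≤ 1 := by exact_mod_cast hd
      · have h1 := hx3 l ⟨1, by omega⟩
        have h2 : l ∈ cycIntTo l (a l ⟨1, by omega⟩) := by
          simp only [cycIntTo, Finset.mem_filter, Finset.mem_univ, true_and]
          have h3 : a l ⟨0, by omega⟩ - l < a l ⟨1, by omega⟩ - l :=
            haMono l (by simp [Fin.lt_def])
          have h4 : (l - l).val = 0 := by rw [PosPoly.subval]; simp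
          rw [h4]
          exact lt_of_le_of_lt (Nat.zero_le _) h3
        have h5 := Finset.single_le_sum (f := x) (fun i _ => hx2 i) h2
        simp only [Nat.cast_one] at h1
        linarith
    let y : ℕ → ℝ := fun m => ∑ i ∈ Finset.univ.filter (fun i : Fin n => i.val < m), x i
    have hy : ∀ l : Fin n, y (l.val + 1) - y l.val = x l := by
      intro l
      have : (Finset.univ.filter fun i : Fin n => i.val < l.val + 1)
          = insert l (Finset.univ.filter fun i : Fin n => i.val < l.val) := by
        ext i
        simp only [Finset.mem_filter, Finset.mem_univ, true_and, Finset.mem_insert, Fin.ext_iff]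
        omega
      simp only [y, this]
      rw [Finset.sum_insert (by simp)]
      ring
    have hy0 : y 0 = 0 := by simp [y]
    have hyn : y n = d := by
      simp only [y]
      rw [← hx1]
      refine Finset.sum_congr ?_ fun _ _ => rfl
      ext i; simp
    have hxy : x = fun l : Fin n => y (l.val + 1) - y l.val := by
      funext l; exact (hy l).symm
    have hx3' : ∀ (j : Fin n) (k : Fin d), (if j.val ≤ (a j k).val then y (a j k).val - y j.val
        else (y n - y 0) - (y j.val - y (a j k).val)) ≤ (k.val : ℝ) := by
      intro j k
      rw [← PosPoly.cyc_sum]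
      rw [Finset.sum_congr rfl fun l _ => hy l]
      exact hx3 j k
    rw [hxy]
    refine PosPoly.mem_hull _ ?_ y ?_
    · refine (Set.finite_range (fun B : Finset (Fin n) => fun i => if i ∈ B then (1 : ℝ) else 0)).subset ?_
      rintro _ ⟨B, _, rfl⟩
      exact ⟨B, rfl⟩
    · intro t
      let Y : ℕ → ℝ := fun m => (⌊y m + t⌋ : ℝ)
      have hXeq : (fun l : Fin n => ((⌊y (l.val + 1) + t⌋ : ℝ) - (⌊y l.val + t⌋ : ℝ)))
          = fun l : Fin n => Y (l.val + 1) - Y l.val := rfl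
      rw [hXeq]
      let B : Finset (Fin n) := Finset.univ.filter fun l => Y (l.val + 1) - Y l.val = 1
      have hXB : (fun l : Fin n => Y (l.val + 1) - Y l.val) = fun l => if l ∈ B then (1:ℝ) else 0 := by
        funext l
        by_cases hl : Y (l.val + 1) - Y l.val = 1
        · simp [B, hl]
        · have h1 := hle1 l
          have h2 := hx2 l
          rw [← hy l] at h1 h2
          have e1 := PosPoly.floor_sub_le (y (l.val + 1)) (y l.val) 1 (by simpa using h1) t
          have e2 := PosPoly.floor_sub_le (y l.val) (y (l.val + 1)) 0 (by simp; linarith) t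
          have e3 : ⌊y (l.val + 1) + t⌋ - ⌊y l.val + t⌋ ≤ 1 := by exact_mod_cast e1
          have e4 : ⌊y l.val + t⌋ - ⌊y (l.val + 1) + t⌋ ≤ 0 := by exact_mod_cast e2
          have e5 : ⌊y (l.val + 1) + t⌋ - ⌊y l.val + t⌋ ≠ 1 := by
            intro h
            apply hl
            simp only [Y]
            exact_mod_cast h
          have e6 : ⌊y (l.val + 1) + t⌋ = ⌊y l.val + t⌋ := by omega
          simp [B, Y, e6]
      have hYn : Y n - Y 0 = d := by
        simp only [Y, hy0, hyn]
        rw [add_comm (d : ℝ) t, Int.floor_add_natCast, zero_add]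
        push_cast; ring
      have hXl : ∀ l : Fin n, Y (l.val + 1) - Y l.val = if l ∈ B then (1:ℝ) else 0 := fun l => congrFun hXB l
      refine ⟨B, ?_, hXB⟩
      refine PosPoly.oh_necklace n d A ℬ hA hrep I hIbase a haMono haEnum B ?_ ?_
      · have h1 := PosPoly.sum_range_filter (n := n) Y 0 n (by omega) le_rfl
        rw [hYn, Finset.sum_congr rfl fun l _ => hXl l, PosPoly.sum_indicator] at h1
        have h2 : (B.filter fun x => x ∈ Finset.univ.filter fun l : Fin n => 0 ≤ l.val ∧ l.val < n) = B := by
          ext i; simp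
        rw [h2] at h1
        exact_mod_cast h1
      · intro j k
        have h1 := PosPoly.cyc_sum Y j (a j k)
        rw [Finset.sum_congr rfl fun l _ => hXl l, PosPoly.sum_indicator] at h1
        have h2 : ((B.filter fun x => x ∈ cycIntTo j (a j k)).card : ℝ) ≤ (k.val : ℝ) := by
          rw [h1]
          have h3 := hx3' j k
          split_ifs with hjb
          · rw [if_pos hjb] at h3
            have h4 := PosPoly.floor_sub_le (y (a j k).val) (y j.val) (k.val : ℤ) (by exact_mod_cast h3) t
            rw [Int.cast_natCast] at h4
            exact h4
          · rw [if_neg hjb, hyn, hy0] at h3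
            have h4 := PosPoly.floor_sub_le (y (a j k).val) (y j.val) ((k.val : ℤ) - d)
              (by push_cast; linarith) t
            push_cast at h4
            rw [hYn]
            simp only [Y]
            linarith
        exact_mod_cast h2
end
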